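/- arXiv:1810.10742 — 2 statements merged into one kernel-verified Lean document; each statement's English description precedes it below -/
import Mathlib

section
/- Let f : X → X be a map, φ : X → ℝ an observable, and x ∈ X a point with M_n(x) = max_{0 ≤ k ≤ n−1} φ(f^k(x)) → ∞ as n → ∞; define τ_u^φ(x) = min{n ≥ 0 : φ(f^n(x)) ≥ u}. For constants a_1, a_2 ∈ (0,∞): limsup_{n→∞} log M_n(x)/log n = a_1 if and only if liminf_{u→∞} log τ_u^φ(x)/log u = 1/a_1; and liminf_{n→∞} log M_n(x)/log n = a_2 if and only if limsup_{u→∞} log τ_u^φ(x)/log u = 1/a_2. Moreover, if lim_{n→∞} log M_n(x)/log n exists and lies in (0,∞), then lim_{u→∞} log τ_u^φ(x)/log u exists and equals (lim_{n→∞} log M_n(x)/log n)^{−1}. -/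
open MeasureTheory Filter Set Real

noncomputable section

/-- Maximum process `M_n(x) = max_{0 ≤ k ≤ n-1} φ(f^k x)`. -/
def maxProc {X : Type*} (f : X → X) (φ : X → ℝ) (n : ℕ) (x : X) : ℝ :=
  ⨆ k : Fin n, φ (f^[k] x)

/-- Hitting time of the observable to level `u`:
`τ_u^φ(x) = min {n ≥ 0 : φ(f^n x) ≥ u}`. -/
def hitLevel {X : Type*} (f : X → X) (φ : X → ℝ) (u : ℝ) (x : X) : ℕ :=
  sInf {n : ℕ | u ≤ φ (f^[n] x)}

lemma aux_limsup {α : Type*} (g : α → ℝ) (l : Filter α) (a : ℝ) (ha : 0 < a) :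
    limsup g l = a ↔ (∀ b, a < b → ∀ᶠ t in l, g t ≤ b) ∧
      (∀ b, 0 < b → b < a → ¬ ∀ᶠ t in l, g t ≤ b) := by
  rw [limsup_eq]
  constructor
  · intro h
    have hne : ({b | ∀ᶠ t in l, g t ≤ b} : Set ℝ).Nonempty := by
      by_contra hc
      rw [Set.not_nonempty_iff_eq_empty] at hc
      rw [hc, Real.sInf_empty] at h
      linarith
    have hbd : BddBelow ({b | ∀ᶠ t in l, g t ≤ b} : Set ℝ) := by
      by_contra hc
      rw [Real.sInf_of_not_bddBelow hc] at h
      linarith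
    refine ⟨fun b hb => ?_, fun b _ hb hP => ?_⟩
    · obtain ⟨s, hs, hsb⟩ := exists_lt_of_csInf_lt hne (h.trans_lt hb)
      exact Filter.Eventually.mono hs fun t ht => ht.trans hsb.le
    · have := csInf_le hbd hP
      linarith
  · rintro ⟨h1, h2⟩
    apply csInf_eq_of_forall_ge_of_forall_gt_exists_lt
    · exact ⟨a + 1, h1 _ (by linarith)⟩
    · intro b hb
      by_contra hc
      push Not at hc
      refine h2 (max b (a / 2)) (lt_max_of_lt_right (by linarith)) (max_lt hc (by linarith)) ?_
      exact Filter.Eventually.mono hb fun t ht => ht.trans (le_max_left _ _)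
    · intro w hw
      exact ⟨(a + w) / 2, h1 _ (by linarith), by linarith⟩

lemma aux_liminf {α : Type*} (g : α → ℝ) (l : Filter α) (a : ℝ) (ha : 0 < a) :
    liminf g l = a ↔ (∀ b, 0 < b → b < a → ∀ᶠ t in l, b ≤ g t) ∧
      (∀ b, a < b → ¬ ∀ᶠ t in l, b ≤ g t) := by
  rw [liminf_eq]
  constructor
  · intro h
    have hne : ({b | ∀ᶠ t in l, b ≤ g t} : Set ℝ).Nonempty := by
      by_contra hc
      rw [Set.not_nonempty_iff_eq_empty] at hc
      rw [hc, Real.sSup_empty] at h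
      linarith
    have hbd : BddAbove ({b | ∀ᶠ t in l, b ≤ g t} : Set ℝ) := by
      by_contra hc
      rw [Real.sSup_of_not_bddAbove hc] at h
      linarith
    refine ⟨fun b _ hb => ?_, fun b hb hP => ?_⟩
    · obtain ⟨s, hs, hsb⟩ := exists_lt_of_lt_csSup hne (hb.trans_eq h.symm)
      exact Filter.Eventually.mono hs fun t ht => hsb.le.trans ht
    · have := le_csSup hbd hP
      linarith
  · rintro ⟨h1, h2⟩
    apply csSup_eq_of_forall_le_of_forall_lt_exists_gt
    · exact ⟨a / 2, h1 _ (by linarith) (by linarith)⟩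
    · intro b hb
      by_contra hc
      push Not at hc
      exact h2 b hc hb
    · intro w hw
      obtain ⟨v, hv1, hv2⟩ := exists_between (max_lt hw ha)
      exact ⟨v, h1 v ((le_max_right _ _).trans_lt hv1) hv2, (le_max_left _ _).trans_lt hv1⟩

lemma aux_swap (P Q : ℝ → Prop)
    (h1 : ∀ b c, 0 < b → 0 < c → b * c < 1 → P b → Q c)
    (h2 : ∀ b c, 0 < b → 0 < c → 1 < b * c → Q c → P b) (a : ℝ) (ha : 0 < a) :
    ((∀ b, a < b → P b) ∧ (∀ b, 0 < b → b < a → ¬ P b)) ↔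
    ((∀ c, 0 < c → c < 1 / a → Q c) ∧ (∀ c, 1 / a < c → ¬ Q c)) := by
  have ha' : 0 < 1 / a := by positivity
  constructor
  · rintro ⟨p1, p2⟩
    refine ⟨fun c hc hca => ?_, fun c hca hQ => ?_⟩
    · have : a < 1 / c := by rw [lt_div_iff₀ ha] at hca; rw [lt_div_iff₀ hc]; linarith
      obtain ⟨b, hb1, hb2⟩ := exists_between this
      exact h1 b c (by linarith) hc (by rwa [lt_div_iff₀ hc] at hb2) (p1 b hb1)
    · have hc : 0 < c := by linarith
      have : 1 / c < a := by rw [div_lt_iff₀ ha] at hca; rw [div_lt_iff₀ hc]; linarith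
      obtain ⟨b, hb1, hb2⟩ := exists_between this
      have hb : 0 < b := lt_trans (by positivity) hb1
      exact p2 b hb hb2 (h2 b c hb hc (by rwa [div_lt_iff₀ hc] at hb1) hQ)
  · rintro ⟨q1, q2⟩
    refine ⟨fun b hab => ?_, fun b hb hba hP => ?_⟩
    · have hb : 0 < b := by linarith
      obtain ⟨c, hc1, hc2⟩ := exists_between (one_div_lt_one_div_of_lt ha hab)
      have hc : 0 < c := lt_trans (by positivity) hc1
      exact h2 b c hb hc (by rw [div_lt_iff₀ hb] at hc1; linarith) (q1 c hc hc2)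
    · obtain ⟨c, hc1, hc2⟩ := exists_between (one_div_lt_one_div_of_lt hb hba)
      have hc : 0 < c := lt_trans ha' hc1
      exact q2 c hc1 (h1 b c hb hc (by rw [lt_div_iff₀ hb] at hc2; linarith) hP)

lemma aux_log (K : ℝ) (hK : 1 < K) : ∀ᶠ y : ℝ in atTop, Real.log (2 * y) ≤ K * Real.log y := by
  filter_upwards [Real.tendsto_log_atTop.eventually_ge_atTop (Real.log 2 / (K - 1)),
    eventually_gt_atTop 0] with y h1 h2
  rw [Real.log_mul (by norm_num) h2.ne']
  rw [div_le_iff₀ (by linarith)] at h1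
  linarith

section
variable {M : ℕ → ℝ} {τ : ℝ → ℕ}

lemma aux_tau (key : ∀ u n, 0 < n → (u ≤ M n ↔ τ u < n)) : Tendsto τ atTop atTop := by
  rw [tendsto_atTop]
  intro N
  filter_upwards [eventually_gt_atTop (M (N + 1))] with u hu
  by_contra hc
  have := (key u (N + 1) (by omega)).2 (by omega)
  linarith

lemma aux_E1 (key : ∀ u n, 0 < n → (u ≤ M n ↔ τ u < n))
    (b c : ℝ) (hb : 0 < b) (hc : 0 < c) (hbc : b * c < 1)
    (h : ∀ᶠ n : ℕ in atTop, Real.log (M n) / Real.log n ≤ b) :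
    ∀ᶠ u : ℝ in atTop, c ≤ Real.log (τ u) / Real.log u := by
  have hτ := aux_tau key
  have hbc0 : 0 < b * c := by positivity
  have hK : 1 < 1 / (b * c) := by rw [lt_div_iff₀ hbc0]; linarith
  have e1 := (tendsto_natCast_atTop_atTop.comp hτ).eventually (aux_log _ hK)
  have e2 := ((tendsto_add_atTop_nat 1).comp hτ).eventually h
  filter_upwards [e1, e2, eventually_gt_atTop 1, hτ.eventually_ge_atTop 1] with u h1 h2 h3 h4
  simp only [Function.comp] at h1 h2
  have h5 := (key u (τ u + 1) (by omega)).2 (by omega)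
  have h4' : (1 : ℝ) ≤ τ u := by exact_mod_cast h4
  have hl : 0 < Real.log ((τ u + 1 : ℕ) : ℝ) := Real.log_pos (by push_cast; linarith)
  rw [div_le_iff₀ hl] at h2
  have h6 : Real.log u ≤ Real.log (M (τ u + 1)) := Real.log_le_log (by linarith) h5
  have h7 : Real.log ((τ u + 1 : ℕ) : ℝ) ≤ Real.log (2 * (τ u : ℝ)) :=
    Real.log_le_log (by positivity) (by push_cast; linarith)
  rw [le_div_iff₀ (Real.log_pos h3)]
  have h8 : (b * c) * Real.log ((τ u + 1 : ℕ) : ℝ) ≤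
      (b * c) * (1 / (b * c) * Real.log (τ u)) :=
    mul_le_mul_of_nonneg_left (h7.trans h1) hbc0.le
  have h9 : (b * c) * (1 / (b * c) * Real.log (τ u)) = Real.log (τ u) := by
    field_simp
  have h10 := mul_le_mul_of_nonneg_left (h6.trans h2) hc.le
  linarith

lemma aux_E2 (key : ∀ u n, 0 < n → (u ≤ M n ↔ τ u < n)) (hM : Tendsto M atTop atTop)
    (b c : ℝ) (hb : 0 < b) (hbc : 1 < b * c)
    (h : ∀ᶠ u : ℝ in atTop, c ≤ Real.log (τ u) / Real.log u) :
    ∀ᶠ n : ℕ in atTop, Real.log (M n) / Real.log n ≤ b := by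
  have hτ := (aux_tau key).comp hM
  filter_upwards [hM.eventually h, hM.eventually_gt_atTop 1, eventually_gt_atTop 1,
    hτ.eventually_ge_atTop 1] with n h1 h2 h3 h4
  simp only [Function.comp] at h4
  have h5 := (key (M n) n (by omega)).1 le_rfl
  have h4' : (1 : ℝ) ≤ τ (M n) := by exact_mod_cast h4
  have h6 : Real.log (τ (M n)) ≤ Real.log n :=
    Real.log_le_log (by linarith) (by exact_mod_cast h5.le)
  have hl := Real.log_pos h2
  rw [le_div_iff₀ hl] at h1
  rw [div_le_iff₀ (Real.log_pos (by exact_mod_cast h3))]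
  have h7 := mul_le_mul_of_nonneg_left (h1.trans h6) hb.le
  nlinarith

lemma aux_E3 (key : ∀ u n, 0 < n → (u ≤ M n ↔ τ u < n)) (hM : Tendsto M atTop atTop)
    (b c : ℝ) (hc : 0 < c) (hbc : 1 < b * c)
    (h : ∀ᶠ n : ℕ in atTop, b ≤ Real.log (M n) / Real.log n) :
    ∀ᶠ u : ℝ in atTop, Real.log (τ u) / Real.log u ≤ c := by
  have hτ := aux_tau key
  filter_upwards [hτ.eventually h, hτ.eventually_gt_atTop 1, eventually_gt_atTop 1,
    (hM.comp hτ).eventually_gt_atTop 1] with u h1 h2 h3 h4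
  simp only [Function.comp] at h4
  have h5 : M (τ u) < u := by
    by_contra hh
    exact absurd ((key u (τ u) (by omega)).1 (not_lt.1 hh)) (lt_irrefl _)
  have h6 : Real.log (M (τ u)) ≤ Real.log u := Real.log_le_log (by linarith) h5.le
  have hl : 0 < Real.log (τ u) := Real.log_pos (by exact_mod_cast h2)
  rw [le_div_iff₀ hl] at h1
  rw [div_le_iff₀ (Real.log_pos h3)]
  have h7 := mul_le_mul_of_nonneg_left (h1.trans h6) hc.le
  nlinarith

lemma aux_E4 (key : ∀ u n, 0 < n → (u ≤ M n ↔ τ u < n)) (hM : Tendsto M atTop atTop)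
    (b c : ℝ) (hb : 0 < b) (hc : 0 < c) (hbc : b * c < 1)
    (h : ∀ᶠ u : ℝ in atTop, Real.log (τ u) / Real.log u ≤ c) :
    ∀ᶠ n : ℕ in atTop, b ≤ Real.log (M n) / Real.log n := by
  have hbc0 : 0 < b * c := by positivity
  have hK : 1 < 1 / (b * c) := by rw [lt_div_iff₀ hbc0]; linarith
  have hM2 : Tendsto (fun n => 2 * M n) atTop atTop := hM.const_mul_atTop (by norm_num)
  filter_upwards [hM2.eventually h, hM.eventually (aux_log _ hK), hM.eventually_gt_atTop 1,
    eventually_gt_atTop 1] with n h1 h2 h3 h4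
  have h5 : n ≤ τ (2 * M n) := by
    by_contra hh
    have := (key (2 * M n) n (by omega)).2 (not_le.1 hh)
    linarith
  have h4' : (1 : ℝ) < n := by exact_mod_cast h4
  have h6 : Real.log n ≤ Real.log (τ (2 * M n)) :=
    Real.log_le_log (by linarith) (by exact_mod_cast h5)
  rw [div_le_iff₀ (Real.log_pos (by linarith))] at h1
  rw [le_div_iff₀ (Real.log_pos h4')]
  have h7 := mul_le_mul_of_nonneg_left (h6.trans h1) hb.le
  have h8 := mul_le_mul_of_nonneg_left h2 hbc0.le
  have h9 : (b * c) * (1 / (b * c) * Real.log (M n)) = Real.log (M n) := by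
    field_simp
  linarith

end

lemma aux_key {X : Type*} (f : X → X) (φ : X → ℝ) (x : X)
    (hM : Tendsto (fun n : ℕ => maxProc f φ n x) atTop atTop) (u : ℝ) (n : ℕ) (hn : 0 < n) :
    u ≤ maxProc f φ n x ↔ hitLevel f φ u x < n := by
  have att : ∀ m, 0 < m → u ≤ maxProc f φ m x → ∃ k, k < m ∧ u ≤ φ (f^[k] x) := by
    intro m hm h
    haveI : Nonempty (Fin m) := ⟨⟨0, hm⟩⟩
    obtain ⟨k, hk⟩ := exists_eq_ciSup_of_finite (f := fun k : Fin m => φ (f^[k] x))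
    refine ⟨k, k.2, ?_⟩
    rw [maxProc, ← hk] at h
    exact h
  constructor
  · intro h
    obtain ⟨k, hk, hu⟩ := att n hn h
    exact lt_of_le_of_lt (Nat.sInf_le hu) hk
  · intro h
    obtain ⟨m, hm, hm0⟩ := ((hM.eventually_ge_atTop u).and (eventually_gt_atTop 0)).exists
    obtain ⟨k, _, hu⟩ := att m hm0 hm
    have hmem : u ≤ φ (f^[hitLevel f φ u x] x) :=
      Nat.sInf_mem (s := {n : ℕ | u ≤ φ (f^[n] x)}) ⟨k, hu⟩
    exact hmem.trans (le_ciSup (f := fun k : Fin n => φ (f^[k] x))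
      (Set.finite_range _).bddAbove ⟨_, h⟩)

/-- Proposition: the logarithm law for maxima is equivalent to the logarithm
law for hitting times (pointwise). -/
theorem loglaw_maxima_iff_hitting
    {X : Type*} (f : X → X) (φ : X → ℝ) (x : X)
    (hM : Tendsto (fun n : ℕ => maxProc f φ n x) atTop atTop)
    (a₁ a₂ : ℝ) (ha₁ : 0 < a₁) (ha₂ : 0 < a₂) :
    (limsup (fun n : ℕ => Real.log (maxProc f φ n x) / Real.log n) atTop = a₁ ↔
      liminf (fun u : ℝ =>
        Real.log ((hitLevel f φ u x : ℕ) : ℝ) / Real.log u) atTop = 1 / a₁) ∧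
    (liminf (fun n : ℕ => Real.log (maxProc f φ n x) / Real.log n) atTop = a₂ ↔
      limsup (fun u : ℝ =>
        Real.log ((hitLevel f φ u x : ℕ) : ℝ) / Real.log u) atTop = 1 / a₂) ∧
    (∀ a : ℝ, 0 < a →
      Tendsto (fun n : ℕ => Real.log (maxProc f φ n x) / Real.log n)
        atTop (nhds a) →
      Tendsto (fun u : ℝ => Real.log ((hitLevel f φ u x : ℕ) : ℝ) / Real.log u)
        atTop (nhds a⁻¹)) := by
  have key := aux_key f φ x hM
  refine ⟨?_, ?_, ?_⟩
  · rw [aux_limsup _ _ _ ha₁, aux_liminf _ _ _ (by positivity)]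
    exact aux_swap _ _ (fun b c hb hc h => aux_E1 key b c hb hc h)
      (fun b c hb _ h => aux_E2 key hM b c hb h) a₁ ha₁
  · rw [aux_liminf _ _ _ ha₂, aux_limsup _ _ _ (by positivity)]
    have := aux_swap _ _
      (fun c b hc hb h => aux_E4 key hM b c hb hc (by linarith))
      (fun c b hc _ h => aux_E3 key hM b c hc (by linarith)) (1 / a₂) (by positivity)
    rw [one_div_one_div] at this
    exact this.symm
  · intro a ha h
    rw [tendsto_order] at h ⊢
    have ha' : 0 < a⁻¹ := by positivity
    constructor
    · intro w hw
      obtain ⟨c, hc1, hc2⟩ := exists_between (max_lt hw ha')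
      have hc : 0 < c := (le_max_right _ _).trans_lt hc1
      have hac : a < c⁻¹ := by rwa [lt_inv_comm₀ ha hc]
      obtain ⟨b, hb1, hb2⟩ := exists_between hac
      have hbc : b * c < 1 := by rwa [← one_div, lt_div_iff₀ hc] at hb2
      filter_upwards [aux_E1 key b c (by linarith) hc hbc ((h.2 b hb1).mono fun _ h => h.le)]
        with u hu
      exact ((le_max_left _ _).trans_lt hc1).trans_le hu
    · intro w hw
      obtain ⟨c, hc1, hc2⟩ := exists_between hw
      have hc : 0 < c := ha'.trans hc1
      have hac : c⁻¹ < a := by rwa [inv_lt_comm₀ hc ha]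
      obtain ⟨b, hb1, hb2⟩ := exists_between hac
      have hbc : 1 < b * c := by rwa [← one_div, div_lt_iff₀ hc] at hb1
      filter_upwards [aux_E3 key hM b c hc hbc ((h.1 b hb2).mono fun _ h => h.le)] with u hu
      exact hu.trans_lt hc2
end
end

section
/- Let f_α be the intermittent map with α ≥ 1, let ψ : [0,∞) → ℝ be monotonically decreasing, and set φ(x) = ψ(d(x,x̃)) and M_n(x) = max_{0 ≤ k ≤ n−1} φ(f_α^k(x)). Then for every ε > 0 and Lebesgue-almost every x ∈ S¹: (1) if x̃ = 0, then ψ((log n)^{2+ε}/n^{1/α}) ≤ M_n(x) ≤ ψ(1/(n^{1/α}·(log n)^{2+ε})) for all sufficiently large n; (2) if x̃ ∈ S¹ with x̃ ≠ 0, then ψ((log n)^{4+ε}/n^{1/α}) ≤ M_n(x) ≤ ψ(1/(n^{1/α}·(log n)^{2+ε})) for all sufficiently large n. -/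
open MeasureTheory Filter Set Real

noncomputable section

/-- The Liverani–Saussol–Vaienti intermittent map on `S¹ = [0,1)`:
`f_α(x) = x(1 + 2^α x^α)` for `x < 1/2` and `f_α(x) = 2x − 1` for `x ≥ 1/2`. -/
def lsv (a : ℝ) (x : ℝ) : ℝ :=
  if x < 1 / 2 then x * (1 + 2 ^ a * x ^ a) else 2 * x - 1

/-- The circle distance on `S¹ = [0,1)`: `d(x,y) = min(|x−y|, 1−|x−y|)`. -/
def circDist (x y : ℝ) : ℝ := min |x - y| (1 - |x - y|)

namespace LSV

/-- left branch -/
def gl (a x : ℝ) : ℝ := x * (1 + 2 ^ a * x ^ a)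

/-- derivative of the left branch -/
def gl' (a x : ℝ) : ℝ := 1 + 2 ^ a * (a + 1) * x ^ a

/-- normalised Lebesgue measure on the circle -/
def lam : Measure ℝ := volume.restrict (Ico (0 : ℝ) 1)

instance : IsFiniteMeasure lam := by unfold lam; infer_instance

lemma lsv_left {a x : ℝ} (h : x < 1 / 2) : lsv a x = gl a x := by
  simp only [lsv, gl, if_pos h]

lemma lsv_right {a x : ℝ} (h : 1 / 2 ≤ x) : lsv a x = 2 * x - 1 := by
  simp only [lsv, if_neg (not_lt.mpr h)]

lemma gl_hasDerivAt {a : ℝ} (ha : 1 ≤ a) {x : ℝ} (hx : 0 ≤ x) :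
    HasDerivAt (gl a) (gl' a x) x := by
  have h1 : HasDerivAt (fun x : ℝ => x ^ a) (a * x ^ (a - 1)) x :=
    Real.hasDerivAt_rpow_const (Or.inr ha)
  have h2 := (hasDerivAt_id x).mul ((h1.const_mul (2 ^ a)).const_add 1)
  have h3 : x ^ a = x * x ^ (a - 1) := by
    rcases hx.eq_or_lt with h | h
    · subst h; rw [Real.zero_rpow (by linarith)]; simp
    · rw [Real.rpow_sub_one h.ne']; field_simp
  refine h2.congr_deriv ?_
  simp only [gl', id]
  rw [h3]; ring

lemma gl'_mono {a : ℝ} (ha : 1 ≤ a) {x y : ℝ} (hx : 0 ≤ x) (h : x ≤ y) : gl' a x ≤ gl' a y := by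
  unfold gl'
  have := Real.rpow_le_rpow hx h (by linarith : 0 ≤ a)
  gcongr

lemma gl'_pos {a : ℝ} (ha : 1 ≤ a) {x : ℝ} (hx : 0 ≤ x) : 1 ≤ gl' a x := by
  unfold gl'
  have := Real.rpow_nonneg hx a
  have : 0 ≤ (2:ℝ) ^ a := by positivity
  have : 0 ≤ (2:ℝ) ^ a * (a + 1) * x ^ a := by positivity
  linarith

lemma two_mul_rpow {a : ℝ} {x : ℝ} (hx : 0 ≤ x) : (2:ℝ) ^ a * x ^ a = (2 * x) ^ a := by
  rw [Real.mul_rpow (by norm_num) hx]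

lemma two_mul_rpow_le {a : ℝ} (ha : 1 ≤ a) {x : ℝ} (hx : 0 ≤ x) (hx2 : x ≤ 1 / 2) :
    (2:ℝ) ^ a * x ^ a ≤ 1 := by
  rw [two_mul_rpow hx]
  exact Real.rpow_le_one (by linarith) (by linarith) (by linarith)

lemma gl'_le {a : ℝ} (ha : 1 ≤ a) {x : ℝ} (hx : 0 ≤ x) (hx2 : x ≤ 1 / 2) : gl' a x ≤ a + 2 := by
  unfold gl'
  have := two_mul_rpow_le ha hx hx2
  nlinarith

lemma gl_half {a : ℝ} : gl a (1 / 2) = 1 := by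
  unfold gl; rw [two_mul_rpow (by norm_num)]; norm_num

lemma gl_zero {a : ℝ} : gl a 0 = 0 := by simp [gl]

lemma gl_ge {a x : ℝ} (hx : 0 ≤ x) : x ≤ gl a x := by
  unfold gl
  have := Real.rpow_nonneg hx a
  have : 0 ≤ (2:ℝ) ^ a * x ^ a := by positivity
  nlinarith

lemma gl_le {a : ℝ} (ha : 1 ≤ a) {x : ℝ} (hx : 0 ≤ x) (hx2 : x ≤ 1 / 2) : gl a x ≤ 2 * x := by
  unfold gl
  have := two_mul_rpow_le ha hx hx2
  nlinarith

lemma gl_expand {a : ℝ} (ha : 1 ≤ a) {x y : ℝ} (hx : 0 ≤ x) (h : x ≤ y) :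
    y - x ≤ gl a y - gl a x := by
  unfold gl
  have h1 := Real.rpow_le_rpow hx h (by linarith : 0 ≤ a)
  have h2 : 0 ≤ x ^ a := Real.rpow_nonneg hx a
  have h3 : 0 ≤ (2:ℝ) ^ a := by positivity
  have : x * x ^ a ≤ y * y ^ a := mul_le_mul h h1 h2 (by linarith)
  nlinarith

lemma gl_lt {a : ℝ} (ha : 1 ≤ a) {x y : ℝ} (hx : 0 ≤ x) (h : x < y) : gl a x < gl a y := by
  have := gl_expand ha hx h.le; linarith

lemma gl_lt_iff {a : ℝ} (ha : 1 ≤ a) {x y : ℝ} (hx : 0 ≤ x) (hy : 0 ≤ y) :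
    gl a x < gl a y ↔ x < y := by
  constructor
  · intro h; by_contra h'; push Not at h'
    have := gl_expand ha hy h'; linarith
  · exact gl_lt ha hx

lemma gl_injOn {a : ℝ} (ha : 1 ≤ a) : InjOn (gl a) (Ici 0) := by
  intro x hx y hy h
  rcases lt_trichotomy x y with h1 | h1 | h1
  · have := gl_lt ha hx h1; linarith
  · exact h1
  · have := gl_lt ha hy h1; linarith

lemma gl_surj {a : ℝ} (ha : 1 ≤ a) {y : ℝ} (hy : y ∈ Icc (0:ℝ) 1) :
    ∃ x ∈ Icc (0:ℝ) (1 / 2), gl a x = y := by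
  have hc : ContinuousOn (gl a) (Icc 0 (1/2)) := fun x hx =>
    (gl_hasDerivAt ha hx.1).continuousAt.continuousWithinAt
  have := intermediate_value_Icc (by norm_num : (0:ℝ) ≤ 1/2) hc
  rw [gl_half, gl_zero] at this
  exact this hy

lemma gl_surj' {a : ℝ} (ha : 1 ≤ a) {y : ℝ} (hy : y ∈ Ico (0:ℝ) 1) :
    ∃ x ∈ Ico (0:ℝ) (1 / 2), gl a x = y := by
  obtain ⟨x, hx, h⟩ := gl_surj ha (Ico_subset_Icc_self hy)
  refine ⟨x, ⟨hx.1, lt_of_le_of_ne hx.2 ?_⟩, h⟩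
  rintro rfl
  rw [gl_half] at h; exact absurd hy.2 (by linarith)

lemma lsv_mem {a : ℝ} (ha : 1 ≤ a) {x : ℝ} (hx : x ∈ Ico (0:ℝ) 1) : lsv a x ∈ Ico (0:ℝ) 1 := by
  rcases lt_or_ge x (1/2) with h | h
  · rw [lsv_left h]
    exact ⟨hx.1.trans (gl_ge hx.1), by have := gl_le ha hx.1 h.le; linarith⟩
  · rw [lsv_right h]; exact ⟨by linarith, by linarith [hx.2]⟩

lemma iter_mem {a : ℝ} (ha : 1 ≤ a) {x : ℝ} (hx : x ∈ Ico (0:ℝ) 1) (k : ℕ) :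
    (lsv a)^[k] x ∈ Ico (0:ℝ) 1 := by
  induction k with
  | zero => exact hx
  | succ k ih => rw [Function.iterate_succ_apply']; exact lsv_mem ha ih

lemma gl_meas {a : ℝ} : Measurable (gl a) := by unfold gl; fun_prop

lemma lsv_meas {a : ℝ} : Measurable (lsv a) := by
  unfold lsv
  exact Measurable.ite measurableSet_Iio (by fun_prop) (by fun_prop)

lemma iter_meas {a : ℝ} (k : ℕ) : Measurable ((lsv a)^[k]) := lsv_meas.iterate k

lemma lam_eq {S : Set ℝ} (h : S ⊆ Ico 0 1) : lam S = volume S := by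
  unfold lam; rw [Measure.restrict_eq_self _ h]

lemma lam_le {S : Set ℝ} : lam S ≤ volume S := Measure.restrict_apply_le _ _

lemma vol_image {a : ℝ} (ha : 1 ≤ a) {S : Set ℝ} (hS : MeasurableSet S) (h : S ⊆ Ici 0) :
    volume (gl a '' S) = ∫⁻ x in S, ENNReal.ofReal (gl' a x) := by
  have := lintegral_image_eq_lintegral_abs_deriv_mul (f := gl a) (f' := gl' a) hS
    (fun x hx => (gl_hasDerivAt ha (h hx)).hasDerivWithinAt) ((gl_injOn ha).mono h) (fun _ => 1)
  rw [setLIntegral_one] at this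
  rw [this]
  simp only [mul_one]
  refine setLIntegral_congr_fun hS fun x hx => ?_
  rw [abs_of_nonneg]
  linarith [gl'_pos ha (h hx)]

lemma vol_image_le {a : ℝ} (ha : 1 ≤ a) {S : Set ℝ} (hS : MeasurableSet S) (h : S ⊆ Ici 0) {K : ℝ}
    (hK : ∀ x ∈ S, gl' a x ≤ K) : volume (gl a '' S) ≤ ENNReal.ofReal K * volume S := by
  rw [vol_image ha hS h]
  calc _ ≤ ∫⁻ x in S, ENNReal.ofReal K := setLIntegral_mono measurable_const
            fun x hx => ENNReal.ofReal_le_ofReal (hK x hx)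
    _ = _ := by simp

lemma vol_image_ge {a : ℝ} (ha : 1 ≤ a) {S : Set ℝ} (hS : MeasurableSet S) (h : S ⊆ Ici 0) {K : ℝ}
    (hK : ∀ x ∈ S, K ≤ gl' a x) : ENNReal.ofReal K * volume S ≤ volume (gl a '' S) := by
  rw [vol_image ha hS h]
  calc _ = ∫⁻ x in S, ENNReal.ofReal K := by simp
    _ ≤ _ := setLIntegral_mono' hS fun x hx => ENNReal.ofReal_le_ofReal (hK x hx)

/-- measures with decreasing density -/
def Dec (ν : Measure ℝ) : Prop := ∀ (c : ℝ) (I E : Set ℝ), MeasurableSet I → MeasurableSet E →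
  I ⊆ Ico 0 c → E ⊆ Ico c 1 → c ≤ 1 → 0 ≤ c → ν E * lam I ≤ lam E * ν I

lemma Dec.add {ν ν' : Measure ℝ} (h : Dec ν) (h' : Dec ν') : Dec (ν + ν') := by
  intro c I E hI hE h1 h2 h3 h4
  have := h c I E hI hE h1 h2 h3 h4
  have := h' c I E hI hE h1 h2 h3 h4
  simp only [Measure.add_apply, add_mul, mul_add]
  gcongr

lemma dec_lam : Dec lam := by
  intro c I E _ _ _ _ _ _
  exact le_rfl

lemma dec_zero : Dec 0 := by
  intro c I E _ _ _ _ _ _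
  simp

lemma preL {a : ℝ} {E : Set ℝ} (ν : Measure ℝ) (hE : MeasurableSet E) :
    (Measure.map (lsv a) (ν.restrict (Ico 0 (1/2)))) E = ν (gl a ⁻¹' E ∩ Ico 0 (1/2)) := by
  rw [Measure.map_apply lsv_meas hE, Measure.restrict_apply (lsv_meas hE)]
  congr 1
  ext x
  simp only [mem_inter_iff, mem_preimage, mem_Ico]
  constructor
  · rintro ⟨h, h1⟩; rw [lsv_left h1.2] at h; exact ⟨h, h1⟩
  · rintro ⟨h, h1⟩; rw [lsv_left h1.2]; exact ⟨h, h1⟩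

lemma preR {a : ℝ} {E : Set ℝ} (ν : Measure ℝ) (hE : MeasurableSet E) :
    (Measure.map (lsv a) (ν.restrict (Ico (1/2) 1))) E
      = ν ((fun x => 2 * x - 1) ⁻¹' E ∩ Ico (1/2) 1) := by
  rw [Measure.map_apply lsv_meas hE, Measure.restrict_apply (lsv_meas hE)]
  congr 1
  ext x
  simp only [mem_inter_iff, mem_preimage, mem_Ico]
  constructor
  · rintro ⟨h, h1⟩; rw [lsv_right h1.1] at h; exact ⟨h, h1⟩
  · rintro ⟨h, h1⟩; rw [lsv_right h1.1]; exact ⟨h, h1⟩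

lemma ico_half_sub : Ico (0:ℝ) (1/2) ⊆ Ico 0 1 := Ico_subset_Ico le_rfl (by norm_num)

/-- lower bound on left preimages -/
lemma lam_preL_ge {a : ℝ} (ha : 1 ≤ a) {I : Set ℝ} (hI : MeasurableSet I) (h : I ⊆ Ico 0 1) {K : ℝ}
    (hK : ∀ x ∈ gl a ⁻¹' I ∩ Ico 0 (1/2), gl' a x ≤ K) :
    lam I ≤ ENNReal.ofReal K * lam (gl a ⁻¹' I ∩ Ico 0 (1/2)) := by
  rw [lam_eq h, lam_eq (inter_subset_right.trans ico_half_sub)]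
  refine le_trans (measure_mono ?_)
    (vol_image_le ha ((gl_meas hI).inter measurableSet_Ico) (fun x hx => hx.2.1) hK)
  intro y hy
  obtain ⟨x, hx, rfl⟩ := gl_surj' ha (h hy)
  exact ⟨x, ⟨hy, hx⟩, rfl⟩

lemma lam_preL_le {a : ℝ} (ha : 1 ≤ a) {I : Set ℝ} (hI : MeasurableSet I) (h : I ⊆ Ico 0 1) {K : ℝ}
    (hK : ∀ x ∈ gl a ⁻¹' I ∩ Ico 0 (1/2), K ≤ gl' a x) :
    ENNReal.ofReal K * lam (gl a ⁻¹' I ∩ Ico 0 (1/2)) ≤ lam I := by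
  rw [lam_eq h, lam_eq (inter_subset_right.trans ico_half_sub)]
  refine le_trans 
    (vol_image_ge ha ((gl_meas hI).inter measurableSet_Ico) (fun x hx => hx.2.1) hK) (measure_mono ?_)
  rintro _ ⟨x, hx, rfl⟩
  exact hx.1

lemma Dec.left {a : ℝ} (ha : 1 ≤ a) {ν : Measure ℝ} (h : Dec ν) :
    Dec (Measure.map (lsv a) (ν.restrict (Ico 0 (1/2)))) := by
  intro c I E hI hE h1 h2 h3 h4
  rw [preL ν hE, preL ν hI]
  obtain ⟨d, hd, rfl⟩ := gl_surj ha ⟨h4, h3⟩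
  set I' := gl a ⁻¹' I ∩ Ico 0 (1/2)
  set E' := gl a ⁻¹' E ∩ Ico 0 (1/2)
  have hI1 : I' ⊆ Ico 0 d := fun x hx => ⟨hx.2.1, (gl_lt_iff ha hx.2.1 hd.1).1 (h1 hx.1).2⟩
  have hE1 : E' ⊆ Ico d 1 := fun x hx => ⟨by
    by_contra h'; push Not at h'
    have := gl_lt ha hx.2.1 h'
    have := (h2 hx.1).1; linarith, by linarith [hx.2.2]⟩
  have hI' : MeasurableSet I' := (gl_meas hI).inter measurableSet_Ico
  have hE' : MeasurableSet E' := (gl_meas hE).inter measurableSet_Ico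
  have key := h d I' E' hI' hE' hI1 hE1 (by linarith [hd.2]) hd.1
  have k1 : lam I ≤ ENNReal.ofReal (gl' a d) * lam I' := 
    lam_preL_ge ha hI (h1.trans (Ico_subset_Ico le_rfl h3)) 
      fun x hx => gl'_mono ha hx.2.1 (hI1 hx).2.le
  have k2 : ENNReal.ofReal (gl' a d) * lam E' ≤ lam E := 
    lam_preL_le ha hE (h2.trans (Ico_subset_Ico h4 le_rfl)) 
      fun x hx => gl'_mono ha hd.1 (hE1 hx).1
  calc ν E' * lam I ≤ ν E' * (ENNReal.ofReal (gl' a d) * lam I') := by gcongr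
    _ = ENNReal.ofReal (gl' a d) * (ν E' * lam I') := by ring
    _ ≤ ENNReal.ofReal (gl' a d) * (lam E' * ν I') := by gcongr
    _ = (ENNReal.ofReal (gl' a d) * lam E') * ν I' := by ring
    _ ≤ _ := by gcongr

lemma lam_preR {E : Set ℝ} (hE : E ⊆ Ico 0 1) :
    lam E = 2 * lam ((fun x => 2 * x - 1) ⁻¹' E ∩ Ico (1/2) 1) := by
  have h0 : (fun x : ℝ => 2 * x - 1) ⁻¹' E ⊆ Ico (1/2) 1 := by
    intro x hx; have := hE hx; simp only [mem_Ico] at *; constructor <;> linarith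
  rw [inter_eq_left.2 h0, lam_eq hE, lam_eq (h0.trans (Ico_subset_Ico (by norm_num) le_rfl))]
  have : (fun x : ℝ => 2 * x - 1) ⁻¹' E = (fun x => 2 * x) ⁻¹' ((fun x => x + (-1)) ⁻¹' E) := by
    ext x; simp [sub_eq_add_neg]
  rw [this, Real.volume_preimage_mul_left (by norm_num), measure_preimage_add_right, ← mul_assoc]
  rw [show (2:ENNReal) = ENNReal.ofReal 2 by simp, ← ENNReal.ofReal_mul (by norm_num)]
  norm_num

lemma Dec.right {a : ℝ} {ν : Measure ℝ} (h : Dec ν) :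
    Dec (Measure.map (lsv a) (ν.restrict (Ico (1/2) 1))) := by
  intro c I E hI hE h1 h2 h3 h4
  rw [preR ν hE, preR ν hI]
  have hm : Measurable (fun x : ℝ => 2 * x - 1) := by fun_prop
  rw [lam_preR (h1.trans (Ico_subset_Ico le_rfl h3)), lam_preR (h2.trans (Ico_subset_Ico h4 le_rfl))]
  have := h ((c+1)/2) ((fun x => 2 * x - 1) ⁻¹' I ∩ Ico (1/2) 1) 
    ((fun x => 2 * x - 1) ⁻¹' E ∩ Ico (1/2) 1) ((hm hI).inter measurableSet_Ico)
    ((hm hE).inter measurableSet_Ico) 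
    (fun x hx => ⟨by linarith [hx.2.1], by have := (h1 hx.1).2; linarith⟩)
    (fun x hx => ⟨by have := (h2 hx.1).1; linarith, hx.2.2⟩) (by linarith) (by linarith)
  calc _ = 2 * (ν ((fun x => 2 * x - 1) ⁻¹' E ∩ Ico (1/2) 1) *
            lam ((fun x => 2 * x - 1) ⁻¹' I ∩ Ico (1/2) 1)) := by ring
    _ ≤ 2 * (lam ((fun x => 2 * x - 1) ⁻¹' E ∩ Ico (1/2) 1) *
            ν ((fun x => 2 * x - 1) ⁻¹' I ∩ Ico (1/2) 1)) := by gcongr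
    _ = _ := by ring

/-- same itinerary up to time `k` -/
def Agree (a : ℝ) (k : ℕ) (x y : ℝ) : Prop :=
  ∀ i < k, ((lsv a)^[i] x < 1/2 ↔ (lsv a)^[i] y < 1/2)

lemma Agree.symm {a : ℝ} {k : ℕ} {x y : ℝ} (h : Agree a k x y) : Agree a k y x :=
  fun i hi => (h i hi).symm

lemma Agree.trans {a : ℝ} {k : ℕ} {x y z : ℝ} (h : Agree a k x y) (g : Agree a k y z) :
    Agree a k x z :=
  fun i hi => (h i hi).trans (g i hi)

/-- sets determined by the first `k` symbols -/
def Det (a : ℝ) (k : ℕ) (A : Set ℝ) : Prop :=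
  A ⊆ Ico 0 1 ∧ ∀ x ∈ Ico (0:ℝ) 1, ∀ y ∈ Ico (0:ℝ) 1, Agree a k x y → x ∈ A → y ∈ A

lemma det_main {a : ℝ} (ha : 1 ≤ a) (k : ℕ) : ∀ A : Set ℝ, Det a k A →
    MeasurableSet A ∧ Dec (Measure.map ((lsv a)^[k]) (lam.restrict A)) := by
  induction k with
  | zero =>
    intro A hA
    rcases A.eq_empty_or_nonempty with h | ⟨x, hx⟩
    · subst h
      simpa using dec_zero
    · have : A = Ico 0 1 := by
        refine hA.1.antisymm fun y hy => hA.2 x (hA.1 hx) y hy (fun i hi => by omega) hx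
      subst this
      refine ⟨measurableSet_Ico, ?_⟩
      have : lam.restrict (Ico 0 1) = lam := by
        unfold lam; rw [Measure.restrict_restrict measurableSet_Ico, inter_self]
      rw [this]
      simpa using dec_lam
  | succ k ih =>
    intro A hA
    set A0 : Set ℝ := {x | x ∈ Ico (0:ℝ) 1 ∧ ∃ y ∈ A, Agree a k y x ∧ (lsv a)^[k] y < 1/2} with hA0
    set A1 : Set ℝ := {x | x ∈ Ico (0:ℝ) 1 ∧ ∃ y ∈ A, Agree a k y x ∧ ¬ (lsv a)^[k] y < 1/2} with hA1
    have d0 : Det a k A0 := by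
      refine ⟨fun x hx => hx.1, ?_⟩
      rintro x hx y hy hxy ⟨_, z, hz, h1, h2⟩
      exact ⟨hy, z, hz, h1.trans hxy, h2⟩
    have d1 : Det a k A1 := by
      refine ⟨fun x hx => hx.1, ?_⟩
      rintro x hx y hy hxy ⟨_, z, hz, h1, h2⟩
      exact ⟨hy, z, hz, h1.trans hxy, h2⟩
    obtain ⟨m0, D0⟩ := ih A0 d0
    obtain ⟨m1, D1⟩ := ih A1 d1
    have hk := iter_meas (a := a) k
    have key : A = (A0 ∩ (lsv a)^[k] ⁻¹' (Ico 0 (1/2))) ∪ (A1 ∩ (lsv a)^[k] ⁻¹' (Ico (1/2) 1)) := by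
      ext x
      constructor
      · intro hx
        have hx1 := hA.1 hx
        have := iter_mem ha hx1 k
        by_cases h : (lsv a)^[k] x < 1/2
        · exact Or.inl ⟨⟨hx1, x, hx, fun i _ => Iff.rfl, h⟩, this.1, h⟩
        · exact Or.inr ⟨⟨hx1, x, hx, fun i _ => Iff.rfl, h⟩, not_lt.1 h, this.2⟩
      · rintro (⟨⟨hx1, y, hy, h1, h2⟩, h3⟩ | ⟨⟨hx1, y, hy, h1, h2⟩, h3⟩)
        · refine hA.2 y (hA.1 hy) x hx1 (fun i hi => ?_) hy
          rcases Nat.lt_succ_iff_lt_or_eq.1 hi with h | rfl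
          · exact h1 i h
          · simp [h2, h3.2, -one_div]
        · refine hA.2 y (hA.1 hy) x hx1 (fun i hi => ?_) hy
          rcases Nat.lt_succ_iff_lt_or_eq.1 hi with h | rfl
          · exact h1 i h
          · simp [h2, not_lt.2 h3.1, -one_div]
    have M0 : MeasurableSet (A0 ∩ (lsv a)^[k] ⁻¹' (Ico 0 (1/2))) := m0.inter (hk measurableSet_Ico)
    have M1 : MeasurableSet (A1 ∩ (lsv a)^[k] ⁻¹' (Ico (1/2) 1)) := m1.inter (hk measurableSet_Ico)
    refine ⟨by rw [key]; exact M0.union M1, ?_⟩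
    have : Measure.map ((lsv a)^[k+1]) (lam.restrict A) =
        Measure.map (lsv a) ((Measure.map ((lsv a)^[k]) (lam.restrict A0)).restrict (Ico 0 (1/2))) +
        Measure.map (lsv a) ((Measure.map ((lsv a)^[k]) (lam.restrict A1)).restrict (Ico (1/2) 1)) := by
      ext E hE
      have hE' := lsv_meas (a := a) hE
      rw [Measure.add_apply, Measure.map_apply (iter_meas _) hE,
        Measure.restrict_apply (iter_meas _ hE), Measure.map_apply lsv_meas hE,
        Measure.map_apply lsv_meas hE, Measure.restrict_apply hE', Measure.restrict_apply hE',
        Measure.map_apply hk (hE'.inter measurableSet_Ico),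
        Measure.map_apply hk (hE'.inter measurableSet_Ico),
        Measure.restrict_apply (hk (hE'.inter measurableSet_Ico)),
        Measure.restrict_apply (hk (hE'.inter measurableSet_Ico))]
      rw [← measure_union]
      · congr 1
        conv_lhs => rw [key]
        rw [Function.iterate_succ']
        ext x
        simp only [mem_inter_iff, mem_union, mem_preimage, Function.comp]
        tauto
      · refine Set.disjoint_left.2 fun x hx hx' => ?_
        have h1 := hx.1.2.2
        have h2 := hx'.1.2.1
        linarith
      · exact (hk (hE'.inter measurableSet_Ico)).inter m1
    rw [this]
    exact (D0.left ha).add D1.right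

/-- mass at time `k` in `E` starting from `A` -/
def mm (a : ℝ) (A : Set ℝ) (k : ℕ) (E : Set ℝ) : ℝ := lam.real (A ∩ (lsv a)^[k] ⁻¹' E)

lemma mm_nonneg {a : ℝ} {A : Set ℝ} {k : ℕ} {E : Set ℝ} : 0 ≤ mm a A k E := measureReal_nonneg

lemma mm_mono {a : ℝ} {A : Set ℝ} {k : ℕ} {E F : Set ℝ} (h : E ⊆ F) : mm a A k E ≤ mm a A k F :=
  measureReal_mono (inter_subset_inter_right _ (preimage_mono h))

lemma mm_dec {a : ℝ} (ha : 1 ≤ a) {A : Set ℝ} {k : ℕ} (hA : Det a k A) {c : ℝ} {I E : Set ℝ}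
    (hI : MeasurableSet I) (hE : MeasurableSet E) (h1 : I ⊆ Ico 0 c) (h2 : E ⊆ Ico c 1)
    (h3 : c ≤ 1) (h4 : 0 ≤ c) : mm a A k E * lam.real I ≤ lam.real E * mm a A k I := by
  obtain ⟨_, D⟩ := det_main ha k A hA
  have := D c I E hI hE h1 h2 h3 h4
  rw [Measure.map_apply (iter_meas _) hE, Measure.map_apply (iter_meas _) hI,
    Measure.restrict_apply (iter_meas _ hE), Measure.restrict_apply (iter_meas _ hI),
    inter_comm _ A, inter_comm _ A] at this
  unfold mm Measure.real
  rw [← ENNReal.toReal_mul, ← ENNReal.toReal_mul]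
  exact ENNReal.toReal_mono (ENNReal.mul_ne_top (measure_ne_top _ _) (measure_ne_top _ _)) this

lemma lam_univ : lam.real univ = 1 := by
  simp [lam, Measure.real]

lemma lam_le_one (S : Set ℝ) : lam.real S ≤ 1 := by
  rw [← lam_univ]; exact measureReal_mono (subset_univ _)

lemma lam_Ico {x y : ℝ} (h0 : 0 ≤ x) (h : x ≤ y) (h1 : y ≤ 1) : lam.real (Ico x y) = y - x := by
  unfold Measure.real
  rw [lam_eq (Ico_subset_Ico h0 h1), Real.volume_Ico, ENNReal.toReal_ofReal (by linarith)]

lemma sum_le_count {n : ℕ} {S : ℕ → Set ℝ} (hS : ∀ k, MeasurableSet (S k)) (L : ℕ)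
    (h : ∀ x ∈ Ico (0:ℝ) 1, ∀ T : Finset ℕ, (∀ k ∈ T, k < n ∧ x ∈ S k) → T.card ≤ L) :
    ∑ k ∈ Finset.range n, lam.real (S k) ≤ L := by
  classical
  have h1 : ∑ k ∈ Finset.range n, lam (S k) ≤ L := by
    calc ∑ k ∈ Finset.range n, lam (S k) 
        = ∑ k ∈ Finset.range n, ∫⁻ x, (S k).indicator 1 x ∂lam := by
          refine Finset.sum_congr rfl fun k _ => ?_
          rw [lintegral_indicator_one (hS k)]
      _ = ∫⁻ x, ∑ k ∈ Finset.range n, (S k).indicator 1 x ∂lam := by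
          rw [lintegral_finsetSum]
          intro k _
          exact measurable_one.indicator (hS k)
      _ ≤ ∫⁻ x, L ∂lam := by
          unfold lam
          refine setLIntegral_mono measurable_const fun x hx => ?_
          have := h x hx ((Finset.range n).filter (fun k => x ∈ S k)) (by simp)
          calc ∑ k ∈ Finset.range n, (S k).indicator (1 : ℝ → ENNReal) x 
              = ∑ k ∈ Finset.range n, if x ∈ S k then 1 else 0 := by
                refine Finset.sum_congr rfl fun k _ => ?_
                simp [indicator_apply]
            _ = (((Finset.range n).filter (fun k => x ∈ S k)).card : ENNReal) := by simp
            _ ≤ L := by exact_mod_cast this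
      _ = L := by simp [lam]
  have : ∑ k ∈ Finset.range n, lam.real (S k) = (∑ k ∈ Finset.range n, lam (S k)).toReal := by
    rw [ENNReal.toReal_sum (fun k _ => measure_ne_top _ _)]; rfl
  rw [this]
  have := ENNReal.toReal_mono (by simp) h1
  simpa using this

/-- the sequence of preimages of 1/2 under the left branch -/
def IsX (a : ℝ) (xs : ℕ → ℝ) : Prop :=
  xs 0 = 1 ∧ ∀ n, 0 < xs (n+1) ∧ xs (n+1) ≤ 1/2 ∧ gl a (xs (n+1)) = xs n

lemma exists_X {a : ℝ} (ha : 1 ≤ a) : ∃ xs, IsX a xs := by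
  have : ∀ y : Ioc (0:ℝ) 1, ∃ x : Ioc (0:ℝ) 1, x.1 ≤ 1/2 ∧ gl a x = y := by
    rintro ⟨y, hy⟩
    obtain ⟨x, hx, h⟩ := gl_surj ha (Ioc_subset_Icc_self hy)
    refine ⟨⟨x, lt_of_le_of_ne hx.1 ?_, by linarith [hx.2]⟩, hx.2, h⟩
    rintro rfl
    rw [gl_zero] at h; exact absurd hy.1 (by linarith)
  choose F hF1 hF2 using this
  refine ⟨fun n => (F^[n] ⟨1, by norm_num, le_rfl⟩ : Ioc (0:ℝ) 1), rfl, fun n => ?_⟩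
  simp only [Function.iterate_succ_apply']
  exact ⟨(F _).2.1, hF1 _, hF2 _⟩

namespace IsX
variable {a : ℝ} {xs : ℕ → ℝ}

lemma pos (h : IsX a xs) (n : ℕ) : 0 < xs n := by
  cases n with
  | zero => rw [h.1]; norm_num
  | succ n => exact (h.2 n).1

lemma le_one (h : IsX a xs) (n : ℕ) : xs n ≤ 1 := by
  cases n with
  | zero => rw [h.1]
  | succ n => linarith [(h.2 n).2.1]

lemma succ_le (h : IsX a xs) (n : ℕ) : xs (n+1) ≤ xs n := by
  rw [← (h.2 n).2.2]; exact gl_ge (h.2 n).1.le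

lemma anti (h : IsX a xs) : Antitone xs := antitone_nat_of_succ_le h.succ_le

lemma le_two (ha : 1 ≤ a) (h : IsX a xs) (n : ℕ) : xs n ≤ 2 * xs (n+1) := by
  rw [← (h.2 n).2.2]; exact gl_le ha (h.2 n).1.le (h.2 n).2.1

lemma one_eq (ha : 1 ≤ a) (h : IsX a xs) : xs 1 = 1/2 := by
  apply gl_injOn ha (h.pos 1).le (by norm_num : (0:ℝ) ≤ 1/2)
  rw [gl_half, (h.2 0).2.2, h.1]

lemma two_lt (ha : 1 ≤ a) (h : IsX a xs) : xs 2 < 1/2 := by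
  rw [← gl_lt_iff ha (h.pos 2).le (by norm_num), (h.2 1).2.2, gl_half, h.one_eq ha]; norm_num

lemma stay (ha : 1 ≤ a) (h : IsX a xs) (n : ℕ) : ∀ x ∈ Ico (0:ℝ) 1,
    ((∀ i < n, (lsv a)^[i] x < 1/2) ↔ x < xs n) := by
  induction n with
  | zero => intro x hx; simp [h.1, hx.2]
  | succ n ih =>
    intro x hx
    have e : (∀ i < n + 1, (lsv a)^[i] x < 1/2) ↔ 
        (x < 1/2 ∧ ∀ i < n, (lsv a)^[i] (lsv a x) < 1/2) := by
      constructor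
      · intro H
        exact ⟨H 0 (by omega), fun i hi => H (i+1) (by omega)⟩
      · rintro ⟨h0, H⟩ i hi
        cases i with
        | zero => exact h0
        | succ i => exact H i (by omega)
    rw [e, ih _ (lsv_mem ha hx)]
    constructor
    · rintro ⟨h1, h2⟩
      rwa [lsv_left h1, ← (h.2 n).2.2, gl_lt_iff ha hx.1 (h.2 n).1.le] at h2
    · intro h1
      have h2 : x < 1/2 := by linarith [(h.2 n).2.1]
      refine ⟨h2, ?_⟩
      rwa [lsv_left h2, ← (h.2 n).2.2, gl_lt_iff ha hx.1 (h.2 n).1.le]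

lemma z_bound (ha : 1 ≤ a) (h : IsX a xs) (n : ℕ) :
    xs n ^ (-a) + 1 ≤ xs (n+1) ^ (-a) ∧ xs (n+1) ^ (-a) ≤ xs n ^ (-a) + a * 2 ^ a := by
  obtain ⟨h1, h2, h3⟩ := h.2 n
  set x := xs (n+1)
  rw [← h3]
  set u := (2:ℝ) ^ a * x ^ a with hu
  have hu0 : 0 < u := by positivity
  have hu1 : u ≤ 1 := two_mul_rpow_le ha h1.le h2
  have e : gl a x ^ (-a) = x ^ (-a) * (1 + u) ^ (-a) := by
    unfold gl; rw [Real.mul_rpow h1.le (by positivity)]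
  have hz : 0 < x ^ (-a) := by positivity
  have hzu : x ^ (-a) * u = 2 ^ a := by
    rw [hu, Real.rpow_neg h1.le]; field_simp
  have b1 : 1 - a * u ≤ (1 + u) ^ (-a) := by
    rw [Real.rpow_def_of_pos (by positivity)]
    have := Real.log_le_sub_one_of_pos (by positivity : 0 < 1 + u)
    have := Real.add_one_le_exp (Real.log (1+u) * (-a))
    nlinarith
  have b2 : (1 + u) ^ (-a) ≤ 1 - u / 2 := by
    have : (1 + u) ^ (-a) ≤ (1 + u) ^ (-1 : ℝ) := 
      Real.rpow_le_rpow_of_exponent_le (by linarith) (by linarith)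
    refine this.trans ?_
    rw [Real.rpow_neg_one, inv_le_iff_one_le_mul₀ (by positivity)]
    nlinarith
  have h2a : (2:ℝ) ≤ 2 ^ a := by
    calc (2:ℝ) = 2 ^ (1:ℝ) := by simp
      _ ≤ _ := Real.rpow_le_rpow_of_exponent_le (by norm_num) ha
  rw [e]
  constructor
  · have := mul_le_mul_of_nonneg_left b2 hz.le
    nlinarith
  · have := mul_le_mul_of_nonneg_left b1 hz.le
    nlinarith

lemma z_bounds (ha : 1 ≤ a) (h : IsX a xs) (n : ℕ) :
    (n + 1 : ℝ) ≤ xs n ^ (-a) ∧ xs n ^ (-a) ≤ (n + 1) * (a * 2 ^ a) := by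
  have h2a : (1:ℝ) ≤ 2 ^ a := Real.one_le_rpow (by norm_num) (by linarith)
  induction n with
  | zero => rw [h.1]; simp; nlinarith
  | succ n ih =>
    have := h.z_bound ha n
    push_cast
    constructor
    · linarith [this.1, ih.1]
    · nlinarith [this.2, ih.2]

lemma upper (ha : 1 ≤ a) (h : IsX a xs) (n : ℕ) : xs n ≤ ((n:ℝ) + 1) ^ (-(1 / a)) := by
  have h1 := (h.z_bounds ha n).1
  have h2 := Real.rpow_le_rpow_of_nonpos (by positivity) h1 (by simp; linarith : -(1/a) ≤ 0)
  rw [← Real.rpow_mul (h.pos n).le] at h2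
  have : -a * -(1 / a) = 1 := by field_simp
  rwa [this, Real.rpow_one] at h2

lemma lower (ha : 1 ≤ a) (h : IsX a xs) (n : ℕ) : 
    1 / xs n ≤ (a * 2 ^ a) ^ (1 / a) * ((n:ℝ) + 1) ^ (1 / a) := by
  have h1 := (h.z_bounds ha n).2
  have hx := h.pos n
  have h2 := Real.rpow_le_rpow (by positivity) h1 (by positivity : 0 ≤ 1/a)
  rw [← Real.rpow_mul (h.pos n).le] at h2
  have : -a * (1 / a) = -1 := by field_simp
  rw [this, Real.rpow_neg_one, Real.mul_rpow (by positivity) (by positivity), mul_comm] at h2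
  simpa using h2

lemma exists_lt (ha : 1 ≤ a) (h : IsX a xs) {t : ℝ} (ht : 0 < t) : ∃ n, xs n ≤ t := by
  have h1 : Tendsto (fun n : ℕ => ((n:ℝ) + 1) ^ (-(1 / a))) atTop (nhds 0) :=
    (tendsto_rpow_neg_atTop (by positivity : 0 < 1 / a)).comp
      (tendsto_atTop_add_const_right _ _ tendsto_natCast_atTop_atTop)
  obtain ⟨n, hn⟩ := (h1.eventually (gt_mem_nhds ht)).exists
  exact ⟨n, (h.upper ha n).trans hn.le⟩

end IsX

lemma det_univ {a : ℝ} (k : ℕ) : Det a k (Ico 0 1) := ⟨le_rfl, fun _ _ _ hy _ _ => hy⟩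

lemma mm_union {a : ℝ} {A : Set ℝ} {k : ℕ} {E F G : Set ℝ} (h : G ⊆ E ∪ F) :
    mm a A k G ≤ mm a A k E + mm a A k F := by
  unfold mm
  refine le_trans (measureReal_mono ?_) (measureReal_union_le _ _)
  rintro x ⟨h1, h2⟩
  rcases h h2 with h3 | h3
  · exact Or.inl ⟨h1, h3⟩
  · exact Or.inr ⟨h1, h3⟩

/-- the mass on `[1/2,1)` -/
def pp (a : ℝ) (A : Set ℝ) (k : ℕ) : ℝ := mm a A k (Ico (1/2) 1)

lemma pp_nonneg {a : ℝ} {A : Set ℝ} {k : ℕ} : 0 ≤ pp a A k := mm_nonneg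

lemma d3 {a : ℝ} (ha : 1 ≤ a) {A : Set ℝ} {k : ℕ} (hA : Det a k A) {t : ℝ} (h0 : 0 ≤ t) (h1 : t ≤ 1) :
    t * pp a A k ≤ mm a A k (Ico (1/2) ((1+t)/2)) := by
  have key := mm_dec ha hA (c := (1+t)/2) (I := Ico (1/2) ((1+t)/2)) (E := Ico ((1+t)/2) 1)
    measurableSet_Ico measurableSet_Ico (Ico_subset_Ico (by norm_num) le_rfl) le_rfl (by linarith)
    (by linarith)
  rw [lam_Ico (by norm_num) (by linarith) (by linarith),
    lam_Ico (by linarith) (by linarith) (by linarith)] at key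
  have h2 : pp a A k ≤ mm a A k (Ico (1/2) ((1+t)/2)) + mm a A k (Ico ((1+t)/2) 1) :=
    mm_union (by rw [Ico_union_Ico_eq_Ico (by linarith) (by linarith)])
  nlinarith

lemma stay_of_E {a : ℝ} (ha : 1 ≤ a) {xs : ℕ → ℝ} (h : IsX a xs) {x : ℝ} (hx : x ∈ Ico (0:ℝ) 1)
    {k j i : ℕ} (h1 : (lsv a)^[k] x ∈ Ico (1/2) ((1 + xs j)/2)) (hi : i < j) :
    (lsv a)^[k+1+i] x < 1/2 := by
  have h2 : (lsv a)^[k+1] x < xs j := by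
    rw [Function.iterate_succ_apply', lsv_right h1.1]; linarith [h1.2]
  have := (h.stay ha j _ (iter_mem ha hx (k+1))).2 h2 i hi
  rwa [← Function.iterate_add_apply, add_comm i] at this

lemma sumP {a : ℝ} (ha : 1 ≤ a) {xs : ℕ → ℝ} (h : IsX a xs) (n : ℕ) :
    ∑ k ∈ Finset.range (n+1), pp a (Ico 0 1) k ≤ 1 / xs n := by
  have h1 := sum_le_count (n := n+1)
    (S := fun k => Ico 0 1 ∩ (lsv a)^[k] ⁻¹' (Ico (1/2) ((1 + xs (n-k))/2)))
    (fun k => measurableSet_Ico.inter (iter_meas k measurableSet_Ico)) 1 (by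
      intro x hx T hT
      refine Finset.card_le_one.2 ?_
      have aux : ∀ k ∈ T, ∀ k' ∈ T, ¬ k < k' := by
        intro k hk k' hk' hlt
        have := stay_of_E ha h hx (hT k hk).2.2 (i := k' - k - 1) (by have := (hT k' hk').1; omega)
        rw [show k + 1 + (k' - k - 1) = k' by omega] at this
        have h2 := (hT k' hk').2.2.1
        linarith
      intro k hk k' hk'
      have := aux k hk k' hk'
      have := aux k' hk' k hk
      omega)
  rw [le_div_iff₀ (h.pos n), Finset.sum_mul]
  refine le_trans (Finset.sum_le_sum fun k hk => ?_) (h1.trans_eq Nat.cast_one)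
  have h2 := d3 ha (det_univ (a := a) k) (h.pos (n-k)).le (h.le_one _)
  have h3 : xs n ≤ xs (n-k) := h.anti (by omega)
  have := pp_nonneg (a := a) (A := Ico 0 1) (k := k)
  calc pp a (Ico 0 1) k * xs n ≤ pp a (Ico 0 1) k * xs (n-k) := by gcongr
    _ = xs (n-k) * pp a (Ico 0 1) k := by ring
    _ ≤ _ := h2

lemma visit_bound {a : ℝ} (ha : 1 ≤ a) {b : ℝ} (hb : 0 < b) (hb1 : b ≤ 1) :
    ∃ C : ℝ, 0 < C ∧ ∀ (n : ℕ) (J : Set ℝ), MeasurableSet J → J ⊆ Ico b 1 →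
      lam.real {x | x ∈ Ico (0:ℝ) 1 ∧ ∃ k ≤ n, (lsv a)^[k] x ∈ J}
        ≤ C * ((n:ℝ)+1) ^ (1/a) * lam.real J := by
  obtain ⟨xs, h⟩ := exists_X ha
  obtain ⟨M, hM⟩ := h.exists_lt ha (half_pos hb)
  have ha0 : 0 < a := by linarith
  refine ⟨(2/b) * ((M+1) * ((a * 2 ^ a) ^ (1 / a) * ((M:ℝ) + 1) ^ (1 / a))), by positivity, ?_⟩
  intro n J hJ hJb
  have s1 : lam.real {x | x ∈ Ico (0:ℝ) 1 ∧ ∃ k ≤ n, (lsv a)^[k] x ∈ J} ≤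
      ∑ k ∈ Finset.range (n+1), mm a (Ico 0 1) k J := by
    refine le_trans (measureReal_mono ?_ (measure_ne_top _ _)) (measureReal_biUnion_finset_le _ _)
    rintro x ⟨hx, k, hk, hkJ⟩
    simp only [mem_iUnion]
    exact ⟨k, by simp; omega, hx, hkJ⟩
  have s2 : ∀ k, mm a (Ico 0 1) k J ≤ (2/b) * lam.real J * mm a (Ico 0 1) k (Ico (b/2) b) := by
    intro k
    have key := mm_dec ha (det_univ (a := a) k) (c := b) (I := Ico (b/2) b) (E := J)
      measurableSet_Ico hJ (Ico_subset_Ico (by linarith) le_rfl) hJb hb1 hb.le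
    rw [lam_Ico (by linarith) (by linarith) hb1] at key
    have : mm a (Ico 0 1) k J = (2 / b) * (mm a (Ico 0 1) k J * (b - b/2)) := by field_simp; ring
    rw [this, mul_assoc]
    gcongr
  have s3 : ∀ k, mm a (Ico 0 1) k (Ico (b/2) b) ≤ ∑ i ∈ Finset.range (M+1), pp a (Ico 0 1) (k+i) := by
    intro k
    refine le_trans (measureReal_mono ?_ (measure_ne_top _ _)) (measureReal_biUnion_finset_le _ _)
    rintro x ⟨hx, hxb⟩
    have hm := iter_mem ha hx k
    by_contra hc
    simp only [mem_iUnion, not_exists] at hc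
    have : (lsv a)^[k] x < xs M := (h.stay ha M _ hm).1 (by
      intro i hi
      by_contra h'
      refine hc i (by simp; omega) ⟨hx, ?_⟩
      rw [← Function.iterate_add_apply, add_comm i] at h'
      exact ⟨not_lt.1 h', (iter_mem ha hx _).2⟩)
    linarith [hxb.1]
  have s4 : ∑ k ∈ Finset.range (n+1), mm a (Ico 0 1) k (Ico (b/2) b) ≤ (M+1) * (1 / xs (n+M)) := by
    calc _ ≤ ∑ k ∈ Finset.range (n+1), ∑ i ∈ Finset.range (M+1), pp a (Ico 0 1) (k+i) :=
          Finset.sum_le_sum fun k _ => s3 k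
      _ = ∑ i ∈ Finset.range (M+1), ∑ k ∈ Finset.range (n+1), pp a (Ico 0 1) (k+i) :=
          Finset.sum_comm
      _ ≤ ∑ i ∈ Finset.range (M+1), 1 / xs (n+M) := by
          refine Finset.sum_le_sum fun i hi => ?_
          refine le_trans ?_ (sumP ha h (n+M))
          have : ∑ k ∈ Finset.range (n+1), pp a (Ico 0 1) (k+i) =
              ∑ k ∈ (Finset.range (n+1)).map (addRightEmbedding i), pp a (Ico 0 1) k := by simp
          rw [this]
          refine Finset.sum_le_sum_of_subset_of_nonneg ?_ fun _ _ _ => pp_nonneg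
          intro k hk
          simp at hk hi ⊢
          omega
      _ = _ := by simp
  have s5 : 1 / xs (n+M) ≤ ((a * 2 ^ a) ^ (1 / a) * ((M:ℝ) + 1) ^ (1 / a)) * ((n:ℝ)+1) ^ (1/a) := by
    refine (h.lower ha (n+M)).trans ?_
    have e := Real.mul_rpow (by positivity : (0:ℝ) ≤ (M:ℝ)+1) (by positivity : (0:ℝ) ≤ (n:ℝ)+1) (z := 1/a)
    rw [mul_assoc, ← e]
    gcongr
    push_cast
    nlinarith [(Nat.cast_nonneg n : (0:ℝ) ≤ n), (Nat.cast_nonneg M : (0:ℝ) ≤ M),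
      mul_nonneg (Nat.cast_nonneg n : (0:ℝ) ≤ n) (Nat.cast_nonneg M : (0:ℝ) ≤ M)]
  calc _ ≤ _ := s1
    _ ≤ ∑ k ∈ Finset.range (n+1), (2/b) * lam.real J * mm a (Ico 0 1) k (Ico (b/2) b) :=
        Finset.sum_le_sum fun k _ => s2 k
    _ = (2/b) * lam.real J * ∑ k ∈ Finset.range (n+1), mm a (Ico 0 1) k (Ico (b/2) b) := by
        rw [Finset.mul_sum]
    _ ≤ (2/b) * lam.real J * ((M+1) * (((a * 2 ^ a) ^ (1 / a) * ((M:ℝ) + 1) ^ (1 / a)) * ((n:ℝ)+1) ^ (1/a))) := by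
        gcongr
        exact s4.trans (by gcongr)
    _ = _ := by ring

/-- alive sets: determined, decreasing, with killing only on the right branch -/
structure Alive (a : ℝ) (A : ℕ → Set ℝ) : Prop where
  det : ∀ k, Det a k (A k)
  anti : ∀ k, A (k+1) ⊆ A k
  keep : ∀ k, ∀ x ∈ A k, (lsv a)^[k] x < 1/2 → x ∈ A (k+1)

lemma Alive.mono {a : ℝ} {A : ℕ → Set ℝ} (hA : Alive a A) : Antitone A :=
  antitone_nat_of_succ_le hA.anti

lemma Alive.loss {a : ℝ} (ha : 1 ≤ a) {A : ℕ → Set ℝ} (hA : Alive a A) (k : ℕ) {B : Set ℝ}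
    (hB : MeasurableSet B) (hB1 : B ⊆ Ico 0 1) :
    2 * lam.real B * pp a (A k) k ≤ (a + 2) * mm a (A (k+1)) (k+1) B := by
  have m1 : MeasurableSet (gl a ⁻¹' B ∩ Ico 0 (1/2)) := (gl_meas hB).inter measurableSet_Ico
  have key := mm_dec ha (hA.det k) (c := 1/2) (I := gl a ⁻¹' B ∩ Ico 0 (1/2)) (E := Ico (1/2) 1)
    m1 measurableSet_Ico inter_subset_right le_rfl (by norm_num) (by norm_num)
  rw [lam_Ico (by norm_num) (by norm_num) le_rfl] at key
  have h1 : mm a (A k) k (gl a ⁻¹' B ∩ Ico 0 (1/2)) ≤ mm a (A (k+1)) (k+1) B := by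
    refine measureReal_mono ?_
    rintro x ⟨hx, hx1, hx2⟩
    refine ⟨hA.keep k x hx hx2.2, ?_⟩
    rw [mem_preimage, Function.iterate_succ_apply', lsv_left hx2.2]
    exact hx1
  have h2 : lam.real B ≤ (a+2) * lam.real (gl a ⁻¹' B ∩ Ico 0 (1/2)) := by
    have := lam_preL_ge ha hB hB1 (K := a+2) (fun x hx => gl'_le ha hx.2.1 hx.2.2.le)
    have := ENNReal.toReal_mono (ENNReal.mul_ne_top (by simp) (measure_ne_top _ _)) this
    rwa [ENNReal.toReal_mul, ENNReal.toReal_ofReal (by linarith)] at this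
  have h3 : 0 ≤ pp a (A k) k := pp_nonneg
  change pp a (A k) k * _ ≤ _ at key
  have h4 := mul_le_mul_of_nonneg_right h2 h3
  have h5 : (a+2) * (pp a (A k) k * lam.real (gl a ⁻¹' B ∩ Ico 0 (1/2))) ≤
    (a+2) * ((1 - 1/2) * mm a (A (k+1)) (k+1) B) := by
      refine mul_le_mul_of_nonneg_left (key.trans ?_) (by linarith)
      exact mul_le_mul_of_nonneg_left h1 (by norm_num)
  nlinarith

lemma Alive.upper {a : ℝ} (ha : 1 ≤ a) {xs : ℕ → ℝ} (h : IsX a xs) {A : ℕ → Set ℝ}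
    (hA : Alive a A) (k j : ℕ) :
    mm a (A k) k (Ico (1/2) ((1 + xs j)/2)) ≤ (1 / (1 - 2 * xs 2)) * xs j * pp a (A (k+1)) (k+1) := by
  have h2 := h.two_lt ha
  have hp := h.pos 2
  have hj := h.pos j
  have hj1 := h.le_one j
  have key := mm_dec ha (hA.det k) (c := 1/2) (I := Ico (xs 2) (1/2)) (E := Ico (1/2) ((1 + xs j)/2))
    measurableSet_Ico measurableSet_Ico (Ico_subset_Ico hp.le le_rfl)
    (Ico_subset_Ico le_rfl (by linarith)) (by norm_num) (by norm_num)
  rw [lam_Ico (by linarith) (by linarith) (by norm_num),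
    lam_Ico (by norm_num) (by linarith) (by linarith)] at key
  have h1 : mm a (A k) k (Ico (xs 2) (1/2)) ≤ pp a (A (k+1)) (k+1) := by
    refine measureReal_mono ?_
    rintro x ⟨hx, hx2⟩
    have hx' := hA.keep k x hx hx2.2
    refine ⟨hx', ?_, (iter_mem ha ((hA.det k).1 hx) _).2⟩
    rw [Function.iterate_succ_apply', lsv_left hx2.2, ← h.one_eq ha, ← (h.2 1).2.2]
    have := gl_expand ha hp.le hx2.1
    linarith [hx2.1]
  have h3 : xs j * mm a (A k) k (Ico (xs 2) (1/2)) ≤ xs j * pp a (A (k+1)) (k+1) := by gcongr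
  rw [show (1 / (1 - 2 * xs 2)) * xs j * pp a (A (k+1)) (k+1) =
    (xs j * pp a (A (k+1)) (k+1)) / (1 - 2 * xs 2) by ring, le_div_iff₀ (by linarith)]
  nlinarith

lemma Alive.mass {a : ℝ} (ha : 1 ≤ a) {xs : ℕ → ℝ} (h : IsX a xs) {A : ℕ → Set ℝ}
    (hA : Alive a A) (n : ℕ) :
    lam.real (A n) ≤ xs n + ∑ k ∈ Finset.range n, mm a (A k) k (Ico (1/2) ((1 + xs (n-1-k))/2)) := by
  have h1 : lam.real (Ico 0 (xs n)) = xs n := by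
    rw [lam_Ico le_rfl (h.pos n).le (h.le_one n)]; ring
  have : A n ⊆ Ico 0 (xs n) ∪ ⋃ k ∈ Finset.range n, 
      (A k ∩ (lsv a)^[k] ⁻¹' (Ico (1/2) ((1 + xs (n-1-k))/2))) := by
    intro x hx
    have hx1 := (hA.det n).1 hx
    by_cases hs : ∀ i < n, (lsv a)^[i] x < 1/2
    · exact Or.inl ⟨hx1.1, (h.stay ha n x hx1).1 hs⟩
    · right
      classical
      push Not at hs
      obtain ⟨i0, hi0, hi0'⟩ := hs
      set k := Nat.findGreatest (fun i => 1/2 ≤ (lsv a)^[i] x) (n-1) with hk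
      have k1 : 1/2 ≤ (lsv a)^[k] x :=
        Nat.findGreatest_spec (P := fun i => 1/2 ≤ (lsv a)^[i] x) (by omega : i0 ≤ n-1) hi0'
      have k2 : k ≤ n-1 := Nat.findGreatest_le _
      have k3 : ∀ i, k < i → i ≤ n-1 → (lsv a)^[i] x < 1/2 := fun i h1 h2 =>
        not_le.1 (Nat.findGreatest_is_greatest (P := fun i => 1/2 ≤ (lsv a)^[i] x) h1 h2)
      simp only [mem_iUnion, Finset.mem_range]
      refine ⟨k, by omega, hA.mono (by omega : k ≤ n) hx, k1, ?_⟩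
      have := (h.stay ha (n-1-k) _ (iter_mem ha hx1 (k+1))).1 (fun i hi => by
        rw [← Function.iterate_add_apply]
        exact k3 _ (by omega) (by omega))
      rw [Function.iterate_succ_apply', lsv_right k1] at this
      linarith
  calc _ ≤ _ := measureReal_mono this
    _ ≤ _ := measureReal_union_le _ _
    _ ≤ _ := by
      rw [h1]
      gcongr
      exact measureReal_biUnion_finset_le _ _

lemma conv_le {x q : ℕ → ℝ} (hx : ∀ j, 0 ≤ x j) (hq : ∀ j, 0 ≤ q j) (N : ℕ) :
    ∑ n ∈ Finset.range (N+1), ∑ k ∈ Finset.range n, x (n-1-k) * q k ≤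
      (∑ j ∈ Finset.range N, x j) * ∑ k ∈ Finset.range N, q k := by
  rw [Finset.sum_range_succ']
  simp only [Finset.range_zero, Finset.sum_empty, add_zero, add_tsub_cancel_right]
  rw [Finset.sum_range_diag_flip N (fun k j => x j * q k), Finset.sum_mul_sum, Finset.sum_comm]
  rw [Finset.sum_comm]
  rw [Finset.sum_comm (s := Finset.range N) (t := Finset.range N)]
  refine Finset.sum_le_sum fun k hk => ?_
  refine Finset.sum_le_sum_of_subset_of_nonneg ?_ fun _ _ _ => mul_nonneg (hx _) (hq _)
  intro j; simp; omega

lemma Alive.final {a : ℝ} (ha : 1 ≤ a) {xs : ℕ → ℝ} (h : IsX a xs) : 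
    ∃ C : ℝ, 0 < C ∧ ∀ (A : ℕ → Set ℝ) (_ : Alive a A) (B : Set ℝ) (_ : MeasurableSet B)
      (_ : B ⊆ Ico 0 1) (_ : 0 < lam.real B) (L : ℝ) (_ : 1 ≤ L)
      (_ : ∀ n, ∑ k ∈ Finset.range n, mm a (A k) k B ≤ L) (N : ℕ),
      ((N:ℝ)+1) * lam.real (A N) ≤ C * (∑ j ∈ Finset.range (N+1), xs j) * (L / lam.real B) := by
  have h2 := h.two_lt ha
  have hd : 0 < 1 / (1 - 2 * xs 2) := one_div_pos.2 (by linarith)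
  set D := 1 / (1 - 2 * xs 2) with hD
  refine ⟨1 + D * ((a+2)/2), by positivity, ?_⟩
  intro A hA B hB hB1 hB0 L hL hsum N
  set X := ∑ j ∈ Finset.range (N+1), xs j with hX
  have hX0 : 0 ≤ X := Finset.sum_nonneg fun j _ => (h.pos j).le
  have hP : ∑ k ∈ Finset.range N, pp a (A (k+1)) (k+1) ≤ ((a+2)/2) * (L / lam.real B) := by
    have e1 : ∑ k ∈ Finset.range (N+1), 2 * lam.real B * pp a (A k) k ≤ (a+2) * L := by
      calc _ ≤ ∑ k ∈ Finset.range (N+1), (a + 2) * mm a (A (k+1)) (k+1) B :=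
            Finset.sum_le_sum fun k _ => hA.loss ha k hB hB1
        _ = (a+2) * ∑ k ∈ Finset.range (N+1), mm a (A (k+1)) (k+1) B := by rw [Finset.mul_sum]
        _ ≤ (a+2) * L := by
          gcongr
          refine le_trans ?_ (hsum (N+2))
          rw [Finset.sum_range_succ' _ (N+1)]
          linarith [mm_nonneg (a := a) (A := A 0) (k := 0) (E := B)]
    rw [← Finset.mul_sum, Finset.sum_range_succ'] at e1
    have := pp_nonneg (a := a) (A := A 0) (k := 0)
    rw [show ((a+2)/2) * (L / lam.real B) = ((a+2) * L) / (2 * lam.real B) by ring,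
      le_div_iff₀ (by positivity)]
    nlinarith
  have hs : ∑ n ∈ Finset.range (N+1), lam.real (A n) ≤ 
      X + D * (X * ∑ k ∈ Finset.range N, pp a (A (k+1)) (k+1)) := by
    calc _ ≤ ∑ n ∈ Finset.range (N+1), (xs n + ∑ k ∈ Finset.range n, 
              D * (xs (n-1-k) * pp a (A (k+1)) (k+1))) := by
          refine Finset.sum_le_sum fun n _ => (hA.mass ha h n).trans ?_
          gcongr with k hk
          rw [← mul_assoc]
          exact hA.upper ha h k _
      _ = X + D * ∑ n ∈ Finset.range (N+1), ∑ k ∈ Finset.range n, 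
              (xs (n-1-k) * pp a (A (k+1)) (k+1)) := by
          rw [Finset.sum_add_distrib, Finset.mul_sum]
          simp only [Finset.mul_sum]
          rfl
      _ ≤ _ := by
          gcongr
          refine (conv_le (x := xs) (q := fun k => pp a (A (k+1)) (k+1)) (fun j => (h.pos j).le)
            (fun j => pp_nonneg) N).trans ?_
          refine mul_le_mul_of_nonneg_right ?_ (Finset.sum_nonneg fun _ _ => pp_nonneg)
          rw [hX, Finset.sum_range_succ]; linarith [h.pos N]
  have hN : ((N:ℝ)+1) * lam.real (A N) ≤ ∑ n ∈ Finset.range (N+1), lam.real (A n) := by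
    have := Finset.card_nsmul_le_sum (Finset.range (N+1)) (fun n => lam.real (A n)) (lam.real (A N))
      (fun n hn => measureReal_mono (hA.mono (by simp at hn; omega)))
    simpa using this
  have h1 : 1 ≤ L / lam.real B := by
    rw [le_div_iff₀ hB0]; linarith [lam_le_one B]
  calc _ ≤ _ := hN
    _ ≤ _ := hs
    _ ≤ X * (L / lam.real B) + D * (X * (((a+2)/2) * (L / lam.real B))) := by
        gcongr
        nlinarith
    _ = _ := by ring

lemma X_bound {a : ℝ} (ha : 1 ≤ a) {xs : ℕ → ℝ} (h : IsX a xs) (N : ℕ) :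
    ∑ j ∈ Finset.range (N+1), xs j ≤ 
      ((N:ℝ)+1) * ((N:ℝ)+1) ^ (-(1/a)) * (1 + Real.log ((N:ℝ)+1)) := by
  have hN : (0:ℝ) < (N:ℝ)+1 := by positivity
  have ha1 : 1 / a ≤ 1 := by rw [div_le_one (by linarith)]; exact ha
  have t : ∀ j ∈ Finset.range (N+1), xs j ≤ (((N:ℝ)+1) * ((N:ℝ)+1) ^ (-(1/a))) * ((j:ℝ)+1)⁻¹ := by
    intro j hj
    refine (h.upper ha j).trans ?_
    have hj0 : (0:ℝ) < (j:ℝ)+1 := by positivity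
    have hjN : (j:ℝ)+1 ≤ (N:ℝ)+1 := by
      have : j ≤ N := by simp at hj; omega
      gcongr
    have := Real.rpow_le_rpow hj0.le hjN (by linarith : 0 ≤ 1 + -(1/a))
    rw [Real.rpow_add hj0, Real.rpow_add hN, Real.rpow_one, Real.rpow_one] at this
    rw [← div_eq_mul_inv, le_div_iff₀ hj0]
    linarith
  refine (Finset.sum_le_sum t).trans ?_
  rw [← Finset.mul_sum]
  gcongr
  have := harmonic_le_one_add_log (N+1)
  rw [harmonic] at this
  push_cast at this
  exact this

/-- number of right-branch visits before time `j` -/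
def cnt (a : ℝ) (j : ℕ) (z : ℝ) : ℕ :=
  ((Finset.range j).filter (fun i => 1/2 ≤ (lsv a)^[i] z)).card

lemma cnt_succ {a : ℝ} {j : ℕ} {z : ℝ} :
    cnt a (j+1) z = cnt a j z + if 1/2 ≤ (lsv a)^[j] z then 1 else 0 := by
  unfold cnt
  rw [Finset.range_add_one, Finset.filter_insert]
  split_ifs with h
  · rw [Finset.card_insert_of_notMem (by simp)]
  · rfl

lemma Agree.cnt_eq {a : ℝ} {j : ℕ} {x y : ℝ} (h : Agree a j x y) : cnt a j x = cnt a j y := by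
  unfold cnt
  congr 1
  refine Finset.filter_congr fun i hi => ?_
  have := h i (by simpa using hi)
  rw [← not_lt, ← not_lt, this]

lemma Agree.shift {a : ℝ} {k i j : ℕ} {x y : ℝ} (h : Agree a k x y) (hij : i + j ≤ k) :
    Agree a j ((lsv a)^[i] x) ((lsv a)^[i] y) := by
  intro m hm
  rw [← Function.iterate_add_apply, ← Function.iterate_add_apply]
  exact h _ (by omega)

/-- the first `j` symbols of `z` (ending with the `L`-th right visit) force membership in `I` -/
def Conf (a : ℝ) (I : Set ℝ) (L j : ℕ) (z : ℝ) : Prop :=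
  z ∈ Ico (0:ℝ) 1 ∧ 1 ≤ j ∧ 1/2 ≤ (lsv a)^[j-1] z ∧ cnt a j z = L ∧
    ∀ z' ∈ Ico (0:ℝ) 1, Agree a j z z' → z' ∈ I

lemma Conf.agree {a : ℝ} {I : Set ℝ} {L j : ℕ} {z z' : ℝ} (h : Conf a I L j z)
    (hz : z' ∈ Ico (0:ℝ) 1) (h' : Agree a j z z') : Conf a I L j z' := by
  obtain ⟨_, h2, h3, h4, h5⟩ := h
  refine ⟨hz, h2, ?_, by rw [← h4, h'.cnt_eq], fun w hw hw' => h5 w hw (h'.trans hw')⟩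
  have := h' (j-1) (by omega)
  rw [← not_lt] at h3 ⊢
  rwa [← this]

lemma Conf.mem {a : ℝ} {I : Set ℝ} {L j : ℕ} {z : ℝ} (h : Conf a I L j z) : z ∈ I :=
  h.2.2.2.2 z h.1 fun _ _ => Iff.rfl

/-- good target set -/
def BB (a : ℝ) (I : Set ℝ) (L : ℕ) : Set ℝ := {z | ∃ j, Conf a I L j z}

/-- points not yet confirmed to have visited `I` -/
def AA (a : ℝ) (I : Set ℝ) (L k : ℕ) : Set ℝ :=
  {x | x ∈ Ico (0:ℝ) 1 ∧ ¬ ∃ k' j, k' + j ≤ k ∧ Conf a I L j ((lsv a)^[k'] x)}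

lemma BB_meas {a : ℝ} (ha : 1 ≤ a) (I : Set ℝ) (L : ℕ) : MeasurableSet (BB a I L) := by
  have : BB a I L = ⋃ j, {z | Conf a I L j z} := by ext z; simp [BB]
  rw [this]
  refine MeasurableSet.iUnion fun j => (det_main ha j _ ⟨fun z hz => hz.1, ?_⟩).1
  intro x _ y hy hxy hx
  exact Conf.agree hx hy hxy

lemma BB_sub {a : ℝ} (I : Set ℝ) (L : ℕ) : BB a I L ⊆ Ico 0 1 := by
  rintro z ⟨j, h⟩; exact h.1

lemma AA_alive {a : ℝ} (ha : 1 ≤ a) (I : Set ℝ) (L : ℕ) : Alive a (AA a I L) := by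
  refine ⟨fun k => ⟨fun x hx => hx.1, ?_⟩, ?_, ?_⟩
  · intro x hx y hy hxy hxA
    refine ⟨hy, ?_⟩
    rintro ⟨k', j, hk, hc⟩
    exact hxA.2 ⟨k', j, hk, hc.agree (iter_mem ha hx _) (hxy.symm.shift hk)⟩
  · rintro k x ⟨hx, h⟩
    refine ⟨hx, ?_⟩
    rintro ⟨k', j, hk, hc⟩
    exact h ⟨k', j, by omega, hc⟩
  · rintro k x ⟨hx, h⟩ hlt
    refine ⟨hx, ?_⟩
    rintro ⟨k', j, hk, hc⟩
    rcases Nat.lt_or_ge k (k'+j) with h1 | h1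
    · have h2 := hc.2.2.1
      have h3 := hc.2.1
      rw [← Function.iterate_add_apply, show j - 1 + k' = k by omega] at h2
      linarith
    · exact h ⟨k', j, h1, hc⟩

lemma AA_cover {a : ℝ} {I : Set ℝ} {L k : ℕ} {x : ℝ} (hx : x ∈ Ico (0:ℝ) 1)
    (h : x ∉ AA a I L k) : ∃ k' < k, (lsv a)^[k'] x ∈ I := by
  by_contra hc
  refine h ⟨hx, ?_⟩
  rintro ⟨k', j, hk, hcf⟩
  exact hc ⟨k', by have := hcf.2.1; omega, hcf.mem⟩

lemma AA_count {a : ℝ} (ha : 1 ≤ a) {I : Set ℝ} (hI : ∀ z ∈ I, 1/2 ≤ z) (L n : ℕ) :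
    ∑ k ∈ Finset.range n, mm a (AA a I L k) k (BB a I L) ≤ L := by
  refine sum_le_count (S := fun k => AA a I L k ∩ (lsv a)^[k] ⁻¹' (BB a I L))
    (fun k => (det_main ha k _ ((AA_alive ha I L).det k)).1.inter (iter_meas k (BB_meas ha I L))) L ?_
  intro x hx T hT
  rcases T.eq_empty_or_nonempty with rfl | hne
  · simp
  set k1 := T.min' hne
  have hk1 : k1 ∈ T := T.min'_mem hne
  obtain ⟨j, hj⟩ := (hT k1 hk1).2.2
  have hcard := hj.2.2.2.1
  rw [← hcard]
  unfold cnt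
  have hle : ∀ k ∈ T, k1 ≤ k := fun k hk => T.min'_le k hk
  refine Finset.card_le_card_of_injOn (fun k => k - k1) ?_ ?_
  · intro k hk
    have h1 := hle k hk
    obtain ⟨_, h2, j', h3⟩ := hT k hk
    have h4 : k < k1 + j := by
      by_contra h'
      exact h2.2 ⟨k1, j, by omega, hj⟩
    have h5 := hI _ h3.mem
    simp only [Finset.coe_filter, Finset.mem_range, mem_ofPred_eq]
    refine ⟨by omega, ?_⟩
    rwa [← Function.iterate_add_apply, show k - k1 + k1 = k by omega]
  · intro k hk k' hk' h
    have := hle k hk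
    have := hle k' hk'
    simp only at h
    omega

lemma diam {a : ℝ} (ha : 1 ≤ a) {z z' : ℝ} (hz : z ∈ Ico (0:ℝ) 1) (hz' : z' ∈ Ico (0:ℝ) 1) (j : ℕ)
    (h : Agree a j z z') :
    2 ^ (cnt a j z) * |z - z'| ≤ |(lsv a)^[j] z - (lsv a)^[j] z'| := by
  induction j with
  | zero => simp [cnt]
  | succ j ih =>
    have ih' := ih fun i hi => h i (by omega)
    have hs := h j (by omega)
    have m1 := iter_mem ha hz j
    have m2 := iter_mem ha hz' j
    rw [cnt_succ, Function.iterate_succ_apply', Function.iterate_succ_apply']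
    set u := (lsv a)^[j] z
    set v := (lsv a)^[j] z'
    rcases lt_or_ge u (1/2) with h1 | h1
    · have h2 := hs.1 h1
      rw [if_neg (not_le.2 h1), lsv_left h1, lsv_left h2]
      refine ih'.trans ?_
      rcases le_total u v with h3 | h3
      · have := gl_expand ha m1.1 h3
        rw [abs_sub_comm u v, abs_sub_comm (gl a u), abs_of_nonneg (by linarith), abs_of_nonneg (by linarith)]
        exact this
      · have := gl_expand ha m2.1 h3
        rw [abs_of_nonneg (by linarith), abs_of_nonneg (by linarith)]
        exact this
    · have h2 : 1/2 ≤ v := by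
        rw [← not_lt] at h1 ⊢; rwa [← hs]
      rw [if_pos h1, lsv_right h1, lsv_right h2, pow_succ]
      rw [show 2 * u - 1 - (2 * v - 1) = 2 * (u - v) by ring, abs_mul, abs_two]
      nlinarith

/-- the exceptional set -/
def ZZ (a : ℝ) : Set ℝ := {x | ∃ k, (lsv a)^[k] x = 0}

lemma pre_null {a : ℝ} (ha : 1 ≤ a) (k : ℕ) : lam (Ico 0 1 ∩ (lsv a)^[k] ⁻¹' {1/2}) = 0 := by
  have key := mm_dec ha (det_univ (a := a) k) (c := 1/2) (I := Ico 0 (1/2)) (E := {1/2})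
    measurableSet_Ico (measurableSet_singleton _) le_rfl (by
      rintro x hx; rw [mem_singleton_iff] at hx; subst hx; constructor <;> norm_num)
      (by norm_num) (by norm_num)
  have h0 : lam.real {(1/2:ℝ)} = 0 := by
    unfold Measure.real; rw [le_antisymm (lam_le.trans (by simp)) (zero_le)]; simp
  rw [lam_Ico le_rfl (by norm_num) (by norm_num), h0] at key
  have h1 : mm a (Ico 0 1) k {1/2} = 0 := le_antisymm (by nlinarith) mm_nonneg
  unfold mm at h1
  rwa [measureReal_eq_zero_iff] at h1

lemma ZZ_null {a : ℝ} (ha : 1 ≤ a) : lam (ZZ a) = 0 := by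
  have hsub : ZZ a ∩ Ico 0 1 ⊆ {0} ∪ ⋃ k, (Ico 0 1 ∩ (lsv a)^[k] ⁻¹' {1/2}) := by
    rintro x ⟨⟨k, hk⟩, hx⟩
    induction k with
    | zero => left; exact hk
    | succ k ih =>
      rw [Function.iterate_succ_apply'] at hk
      have hm := iter_mem ha hx k
      rcases lt_or_ge ((lsv a)^[k] x) (1/2) with h | h
      · rw [lsv_left h] at hk
        have := gl_ge (a := a) hm.1
        exact ih (le_antisymm (by linarith) hm.1)
      · rw [lsv_right h] at hk
        right
        rw [mem_iUnion]
        exact ⟨k, hx, by rw [mem_preimage, mem_singleton_iff]; linarith⟩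
  have h1 : lam (ZZ a ∩ Ico 0 1) = 0 := by
    refine measure_mono_null hsub (measure_union_null ?_ (measure_iUnion_null (pre_null ha)))
    exact le_antisymm (lam_le.trans (by simp)) (zero_le)
  have h2 : lam (Ico 0 1)ᶜ = 0 := by
    unfold lam; rw [Measure.restrict_apply (measurableSet_Ico.compl)]; simp
  refine measure_mono_null (t := (ZZ a ∩ Ico 0 1) ∪ (Ico 0 1)ᶜ) ?_ (measure_union_null h1 h2)
  intro x hx
  by_cases h : x ∈ Ico (0:ℝ) 1
  · exact Or.inl ⟨hx, h⟩
  · exact Or.inr h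

lemma exists_right {a : ℝ} (ha : 1 ≤ a) {z : ℝ} (hz : z ∈ Ico (0:ℝ) 1) (h0 : z ∉ ZZ a) (k : ℕ) :
    ∃ i, k ≤ i ∧ 1/2 ≤ (lsv a)^[i] z := by
  by_contra hc
  push Not at hc
  obtain ⟨xs, h⟩ := exists_X ha
  have hm := iter_mem ha hz k
  have hpos : 0 < (lsv a)^[k] z := lt_of_le_of_ne hm.1 fun e => h0 ⟨k, e.symm⟩
  obtain ⟨n, hn⟩ := h.exists_lt ha hpos
  have := (h.stay ha n _ hm).1 (fun i _ => by
    rw [← Function.iterate_add_apply]; exact hc _ (by omega))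
  linarith

lemma exists_cnt {a : ℝ} (ha : 1 ≤ a) {z : ℝ} (hz : z ∈ Ico (0:ℝ) 1) (h0 : z ∉ ZZ a) (m : ℕ) :
    ∃ j, m ≤ cnt a j z := by
  induction m with
  | zero => exact ⟨0, by omega⟩
  | succ m ih =>
    obtain ⟨j, hj⟩ := ih
    obtain ⟨i, hi, h1⟩ := exists_right ha hz h0 j
    refine ⟨i+1, ?_⟩
    rw [cnt_succ, if_pos h1]
    have : cnt a j z ≤ cnt a i z := by
      unfold cnt
      refine Finset.card_le_card (Finset.filter_subset_filter _ ?_)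
      intro x; simp; omega
    omega

lemma exists_conf {a : ℝ} (ha : 1 ≤ a) {z : ℝ} (hz : z ∈ Ico (0:ℝ) 1) (h0 : z ∉ ZZ a) (m : ℕ)
    (hm : 1 ≤ m) : ∃ j, 1 ≤ j ∧ 1/2 ≤ (lsv a)^[j-1] z ∧ cnt a j z = m := by
  classical
  have hex := exists_cnt ha hz h0 m
  have hsp := Nat.find_spec hex
  have hmin := fun k hk => Nat.find_min hex (m := k) hk
  set j := Nat.find hex
  obtain ⟨i, hi⟩ : ∃ i, j = i + 1 := by
    cases hj : j with
    | zero => rw [hj] at hsp; simp [cnt] at hsp; omega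
    | succ i => exact ⟨i, rfl⟩
  have h1 := hmin i (by omega)
  rw [hi, cnt_succ] at hsp
  refine ⟨i+1, by omega, ?_⟩
  rw [Nat.add_sub_cancel, cnt_succ]
  by_cases h : 1/2 ≤ (lsv a)^[i] z
  · rw [if_pos h] at hsp ⊢; exact ⟨h, by omega⟩
  · rw [if_neg h] at hsp; omega

/-- the target interval on the right branch -/
def II (xt ρ : ℝ) : Set ℝ := {z | 1/2 ≤ z ∧ |2 * z - 1 - xt| ≤ ρ}

lemma BB_ge_of {a : ℝ} (ha : 1 ≤ a) {I : Set ℝ} {L : ℕ} {u v : ℝ} (h0 : 0 ≤ u) (h1 : u ≤ v) (h2 : v ≤ 1)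
    (h : ∀ z ∈ Ico u v, z ∉ ZZ a → z ∈ BB a I L) : v - u ≤ lam.real (BB a I L) := by
  rw [← lam_Ico h0 h1 h2]
  calc lam.real (Ico u v) ≤ lam.real (BB a I L ∪ ZZ a) := by
        refine measureReal_mono fun z hz => ?_
        by_cases hh : z ∈ ZZ a
        · exact Or.inr hh
        · exact Or.inl (h z hz hh)
    _ ≤ lam.real (BB a I L) + lam.real (ZZ a) := measureReal_union_le _ _
    _ = _ := by rw [Measure.real, Measure.real, ZZ_null ha]; simp

lemma agree_half {a : ℝ} {j : ℕ} {z z' : ℝ} (h : Agree a j z z') (hj : 1 ≤ j) (hz : 1/2 ≤ z) :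
    1/2 ≤ z' := by
  have := h 0 (by omega)
  simp only [Function.iterate_zero, id] at this
  rw [← not_lt] at hz ⊢; rwa [← this]

lemma BB_one {a : ℝ} (ha : 1 ≤ a) {xt ρ : ℝ} (hxt : xt ∈ Ico (0:ℝ) 1) (hρ0 : 0 < ρ) (hρ : ρ ≤ 1)
    {L : ℕ} (hL1 : 1 ≤ L) (hL : 4 ≤ ρ * 2 ^ L) : ρ / 4 ≤ lam.real (BB a (II xt ρ) L) := by
  have main : ∀ z ∈ Ico (0:ℝ) 1, 1/2 ≤ z → |2 * z - 1 - xt| ≤ ρ/2 → z ∉ ZZ a → z ∈ BB a (II xt ρ) L := by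
    intro z hz hz2 hd hZ
    obtain ⟨j, hj, hjr, hjc⟩ := exists_conf ha hz hZ L hL1
    refine ⟨j, hz, hj, hjr, hjc, fun z' hz' hag => ⟨agree_half hag hj hz2, ?_⟩⟩
    have hdm := diam ha hz hz' j hag
    have m1 := iter_mem ha hz j
    have m2 := iter_mem ha hz' j
    have hle : |(lsv a)^[j] z - (lsv a)^[j] z'| ≤ 1 := by
      rw [abs_le]; constructor <;> linarith [m1.1, m1.2, m2.1, m2.2]
    rw [hjc] at hdm
    have h3 : |z - z'| ≤ ρ/4 := by
      have hp : (0:ℝ) < 2 ^ L := by positivity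
      have : 2 ^ L * |z - z'| ≤ 2 ^ L * (ρ/4) := by nlinarith
      exact le_of_mul_le_mul_left this hp
    rw [abs_le] at *
    constructor <;> linarith [h3.1, h3.2, hd.1, hd.2]
  obtain ⟨h0, h1⟩ := hxt
  rcases le_total xt (1/2) with hx | hx
  · have := BB_ge_of ha (I := II xt ρ) (L := L) (u := (1+xt)/2) (v := (1+xt)/2 + ρ/4) (by linarith)
      (by linarith) (by linarith) (fun z hz hZ => main z ⟨by linarith [hz.1], by linarith [hz.2]⟩
        (by linarith [hz.1]) (by rw [abs_le]; constructor <;> linarith [hz.1, hz.2]) hZ)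
    linarith
  · have := BB_ge_of ha (I := II xt ρ) (L := L) (u := (1+xt)/2 - ρ/4) (v := (1+xt)/2) (by linarith)
      (by linarith) (by linarith) (fun z hz hZ => main z ⟨by linarith [hz.1], by linarith [hz.2]⟩
        (by linarith [hz.1]) (by rw [abs_le]; constructor <;> linarith [hz.1, hz.2]) hZ)
    linarith

lemma BB_two {a : ℝ} (ha : 1 ≤ a) {ρ : ℝ} (hρ0 : 0 < ρ) (hρ : ρ ≤ 1) :
    ρ / 4 ≤ lam.real (BB a (II 0 ρ) 2) := by
  obtain ⟨xs, h⟩ := exists_X ha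
  have := BB_ge_of ha (I := II 0 ρ) (L := 2) (u := 1/2) (v := 1/2 + ρ/4) (by norm_num)
      (by linarith) (by linarith) ?_
  · linarith
  intro z hz hZ
  have hz1 : z ∈ Ico (0:ℝ) 1 := ⟨by linarith [hz.1], by linarith [hz.2]⟩
  obtain ⟨j, hj, hjr, hjc⟩ := exists_conf ha hz1 hZ 2 (by norm_num)
  refine ⟨j, hz1, hj, hjr, hjc, fun z' hz' hag => ?_⟩
  have hz2 := agree_half hag hj hz.1
  refine ⟨hz2, ?_⟩
  obtain ⟨i, rfl⟩ : ∃ i, j = i + 2 := by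
    rcases Nat.lt_or_ge j 2 with h' | h'
    · have : j = 1 := by omega
      subst this
      rw [cnt_succ] at hjc
      simp only [cnt, Finset.range_zero, Finset.filter_empty, Finset.card_empty] at hjc
      split_ifs at hjc <;> omega
    · exact ⟨j-2, by omega⟩
  have ef : ∀ m w, (1/2:ℝ) ≤ w → (lsv a)^[m+1] w = (lsv a)^[m] (2 * w - 1) := by
    intro m w hw
    rw [Function.iterate_succ_apply, lsv_right hw]
  have mt : 2 * z - 1 ∈ Ico (0:ℝ) 1 := ⟨by linarith [hz.1], by linarith [hz1.2]⟩
  have mtp : 2 * z' - 1 ∈ Ico (0:ℝ) 1 := ⟨by linarith, by linarith [hz'.2]⟩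
  have h1 : xs (i+1) ≤ 2 * z - 1 := by
    by_contra hc
    have := (h.stay ha (i+1) _ mt).2 (not_le.1 hc) i (by omega)
    rw [← ef _ _ hz.1] at this
    rw [show i + 2 - 1 = i + 1 by omega] at hjr
    linarith
  have h2 : 2 * z' - 1 < xs i := by
    refine (h.stay ha i _ mtp).1 fun m hm => ?_
    rw [← ef _ _ hz2, ← hag (m+1) (by omega)]
    by_contra hc
    have hs : ({0, m+1, i+1} : Finset ℕ) ⊆ (Finset.range (i+2)).filter (fun i => 1/2 ≤ (lsv a)^[i] z) := by
      intro k hk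
      simp only [Finset.mem_insert, Finset.mem_singleton] at hk
      simp only [Finset.mem_filter, Finset.mem_range]
      rcases hk with rfl | rfl | rfl
      · exact ⟨by omega, hz.1⟩
      · exact ⟨by omega, not_lt.1 hc⟩
      · exact ⟨by omega, hjr⟩
    have h3 := Finset.card_le_card hs
    have h4 : ({0, m+1, i+1} : Finset ℕ).card = 3 := by
      rw [Finset.card_insert_of_notMem (by simp), Finset.card_pair (by omega)]
    unfold cnt at hjc
    omega
  have h3 := h.le_two ha i
  rw [abs_le]
  constructor <;> linarith [hz.2, mtp.1]

/-- main hitting estimate -/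
lemma hit_bound {a : ℝ} (ha : 1 ≤ a) : ∃ C : ℝ, 0 < C ∧ ∀ (xt ρ : ℝ) (L : ℕ), 0 < ρ → 1 ≤ L →
    ρ / 4 ≤ lam.real (BB a (II xt ρ) L) → ∀ N : ℕ,
    lam.real {x | x ∈ Ico (0:ℝ) 1 ∧ ¬ ∃ k < N + 1, |(lsv a)^[k] x - xt| ≤ ρ} ≤
      C * (((N:ℝ)+1) ^ (-(1/a)) * (1 + Real.log ((N:ℝ)+1))) * (L / ρ) := by
  obtain ⟨xs, h⟩ := exists_X ha
  obtain ⟨C, hC, hf⟩ := Alive.final ha h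
  refine ⟨4 * C, by positivity, ?_⟩
  intro xt ρ L hρ hL hB N
  have hB0 : 0 < lam.real (BB a (II xt ρ) L) := by linarith
  have h1 := hf _ (AA_alive ha (II xt ρ) L) _ (BB_meas ha _ _) (BB_sub _ _) hB0 L
    (by exact_mod_cast hL) (fun n => AA_count ha (fun z hz => hz.1) L n) N
  have h2 : lam.real {x | x ∈ Ico (0:ℝ) 1 ∧ ¬ ∃ k < N + 1, |(lsv a)^[k] x - xt| ≤ ρ} ≤
      lam.real (AA a (II xt ρ) L N) := by
    refine measureReal_mono ?_
    rintro x ⟨hx, hn⟩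
    by_contra hc
    obtain ⟨k, hk, hk2, hk3⟩ := AA_cover hx hc
    refine hn ⟨k+1, by omega, ?_⟩
    rwa [Function.iterate_succ_apply', lsv_right hk2]
  refine h2.trans ?_
  have hN : (0:ℝ) < (N:ℝ)+1 := by positivity
  have hlog : 0 ≤ Real.log ((N:ℝ)+1) := Real.log_nonneg (by linarith [(Nat.cast_nonneg N : (0:ℝ) ≤ N)])
  have h3 : (L:ℝ) / lam.real (BB a (II xt ρ) L) ≤ 4 * (L / ρ) := by
    rw [show 4 * ((L:ℝ) / ρ) = L / (ρ/4) by field_simp]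
    gcongr
  have h4 : ((N:ℝ)+1) * lam.real (AA a (II xt ρ) L N) ≤
      C * (((N:ℝ)+1) * ((N:ℝ)+1) ^ (-(1/a)) * (1 + Real.log ((N:ℝ)+1))) * (4 * (L / ρ)) := by
    refine h1.trans ?_
    have := X_bound ha h N
    gcongr
  refine le_of_mul_le_mul_left (h4.trans_eq ?_) hN
  ring

lemma bc {s : ℕ → Set ℝ} {u : ℕ → ℝ} (hu : Summable u) (h : ∀ᶠ j in atTop, lam.real (s j) ≤ u j) :
    ∀ᵐ x ∂lam, ∀ᶠ j in atTop, x ∉ s j := by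
  have h1 : Summable (fun j => lam.real (s j)) := by
    refine Summable.of_norm_bounded_eventually_nat hu ?_
    filter_upwards [h] with j hj
    rwa [Real.norm_of_nonneg measureReal_nonneg]
  refine ae_eventually_notMem ?_
  have h2 := h1.tsum_ofReal_ne_top
  convert h2 using 3 with j
  rw [Measure.real, ENNReal.ofReal_toReal (measure_ne_top _ _)]

lemma lam_small {E : Set ℝ} {u v : ℝ} (h : E ⊆ Icc u v) (huv : u ≤ v) : lam.real E ≤ v - u := by
  unfold Measure.real
  refine ENNReal.toReal_le_of_le_ofReal (by linarith) ?_
  rw [← Real.volume_Icc]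
  exact lam_le.trans (measure_mono h)

/-- the small radius -/
def SS (a κ t : ℝ) : ℝ := 1 / (t ^ (1/a) * Real.log t ^ κ)

/-- the large radius -/
def RR (a κ t : ℝ) : ℝ := Real.log t ^ κ / t ^ (1/a)

lemma log_two_pow (j : ℕ) : Real.log ((2:ℝ)^j) = j * Real.log 2 := Real.log_pow _ _

lemma genA {a : ℝ} (ha : 1 ≤ a) {κ : ℝ} (hκ : 1 < κ) {b : ℝ} (hb : 0 < b) (hb1 : b ≤ 1)
    {J : ℕ → Set ℝ} (hJ : ∀ j, MeasurableSet (J j)) (hJb : ∀ j, J j ⊆ Ico b 1)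
    (hJm : ∀ᶠ j : ℕ in atTop, lam.real (J j) ≤ 2 * SS a κ ((2:ℝ)^j)) :
    ∀ᵐ x ∂lam, ∀ᶠ j : ℕ in atTop, x ∈ Ico (0:ℝ) 1 → ∀ k ≤ 2^(j+1), (lsv a)^[k] x ∉ J j := by
  obtain ⟨C, hC, hv⟩ := visit_bound ha hb hb1
  have hl2 : 0 < Real.log 2 := Real.log_pos (by norm_num)
  have ha0 : 0 < a := by linarith
  have hsum : Summable (fun j : ℕ => (C * 4 ^ (1/a) * 2 * (Real.log 2 ^ κ)⁻¹) * (j:ℝ) ^ (-κ)) :=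
    (Real.summable_nat_rpow.2 (by linarith)).mul_left _
  have := bc (s := fun j => {x | x ∈ Ico (0:ℝ) 1 ∧ ∃ k ≤ 2^(j+1), (lsv a)^[k] x ∈ J j}) hsum (by
    filter_upwards [hJm, eventually_ge_atTop 1] with j hj hj1
    refine (hv _ _ (hJ j) (hJb j)).trans ?_
    have hj0 : (0:ℝ) < j := by exact_mod_cast hj1
    have e1 : (((2^(j+1) : ℕ) : ℝ) + 1) ^ (1/a) ≤ 4 ^ (1/a) * ((2:ℝ)^j) ^ (1/a) := by
      rw [← Real.mul_rpow (by norm_num) (by positivity)]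
      refine Real.rpow_le_rpow (by positivity) ?_ (by positivity)
      push_cast
      have : (1:ℝ) ≤ 2^j := one_le_pow₀ (by norm_num)
      rw [pow_succ]; linarith
    calc C * (((2^(j+1) : ℕ) : ℝ) + 1) ^ (1/a) * lam.real (J j) 
        ≤ C * (4 ^ (1/a) * ((2:ℝ)^j) ^ (1/a)) * (2 * SS a κ ((2:ℝ)^j)) := by
          gcongr
      _ = _ := by
          unfold SS
          rw [log_two_pow, Real.mul_rpow hj0.le hl2.le, Real.rpow_neg hj0.le]
          have : (0:ℝ) < ((2:ℝ)^j) ^ (1/a) := by positivity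
          have : (0:ℝ) < (j:ℝ) ^ κ := by positivity
          have : (0:ℝ) < Real.log 2 ^ κ := by positivity
          field_simp)
  filter_upwards [this] with x hx
  filter_upwards [hx] with j hj hx1 k hk hkJ
  exact hj ⟨hx1, k, hk, hkJ⟩

lemma two_pow_top : Tendsto (fun j : ℕ => (2:ℝ)^j) atTop atTop :=
  tendsto_pow_atTop_atTop_of_one_lt (by norm_num)

lemma SS_small {a : ℝ} (ha : 1 ≤ a) {κ : ℝ} (hκ : 1 < κ) {δ : ℝ} (hδ : 0 < δ) :
    ∀ᶠ j : ℕ in atTop, SS a κ ((2:ℝ)^j) < δ := by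
  have h1 : Tendsto (fun t : ℝ => t ^ (1/a) * Real.log t ^ κ) atTop atTop :=
    (tendsto_rpow_atTop (by positivity)).atTop_mul_atTop₀
      ((tendsto_rpow_atTop (by linarith)).comp Real.tendsto_log_atTop)
  have h2 : Tendsto (fun t : ℝ => SS a κ t) atTop (nhds 0) := by
    unfold SS; simp only [one_div] at h1 ⊢; exact h1.inv_tendsto_atTop
  exact (h2.comp two_pow_top).eventually (gt_mem_nhds hδ)

lemma SS_pos {a κ : ℝ} {j : ℕ} (hj : 1 ≤ j) : 0 < SS a κ ((2:ℝ)^j) := by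
  unfold SS
  have : 0 < Real.log ((2:ℝ)^j) := Real.log_pos (one_lt_pow₀ (by norm_num) (by omega))
  positivity

lemma upA_ne {a : ℝ} (ha : 1 ≤ a) {κ : ℝ} (hκ : 1 < κ) {xt : ℝ} (h0 : 0 < xt) (h1 : xt < 1) :
    ∀ᵐ x ∂lam, ∀ᶠ j : ℕ in atTop, x ∈ Ico (0:ℝ) 1 → ∀ k ≤ 2^(j+1),
      SS a κ ((2:ℝ)^j) ≤ circDist ((lsv a)^[k] x) xt := by
  have := genA ha hκ (b := xt/2) (by linarith) (by linarith)
    (J := fun j => Ioo (xt - SS a κ ((2:ℝ)^j)) (xt + SS a κ ((2:ℝ)^j)) ∩ Ico (xt/2) 1)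
    (fun j => measurableSet_Ioo.inter measurableSet_Ico) (fun j => inter_subset_right) (by
      filter_upwards [eventually_ge_atTop 1] with j hj
      have := SS_pos (a := a) (κ := κ) hj
      refine (lam_small (inter_subset_left.trans Ioo_subset_Icc_self) (by linarith)).trans_eq (by ring))
  filter_upwards [this] with x hx
  filter_upwards [hx, SS_small ha hκ (by linarith : 0 < xt/2), SS_small ha hκ (by linarith : 0 < 1 - xt),
    eventually_ge_atTop 1] with j h2 h3 h4 hj hx1 k hk
  have hS := SS_pos (a := a) (κ := κ) hj
  have hm := iter_mem ha hx1 k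
  have h5 := h2 hx1 k hk
  set y := (lsv a)^[k] x
  set S := SS a κ ((2:ℝ)^j)
  unfold circDist
  refine le_min ?_ ?_
  · by_contra hc
    rw [not_le, abs_lt] at hc
    exact h5 ⟨⟨by linarith [hc.1], by linarith [hc.2]⟩, by linarith [hc.1], hm.2⟩
  · have : |y - xt| ≤ 1 - S := by
      rw [abs_le]; constructor <;> linarith [hm.1, hm.2]
    linarith

lemma trace_back {a : ℝ} (ha : 1 ≤ a) {x S : ℝ} (hx : x ∈ Ico (0:ℝ) 1) (hS : S ≤ x) (k : ℕ) 
    (h : ∀ i ≤ k, (lsv a)^[i] x ∉ Ico (1/2) (1/2 + S/2)) : S ≤ (lsv a)^[k] x := by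
  induction k with
  | zero => exact hS
  | succ k ih =>
    have ih' := ih fun i hi => h i (by omega)
    have hm := iter_mem ha hx k
    rw [Function.iterate_succ_apply']
    rcases lt_or_ge ((lsv a)^[k] x) (1/2) with h1 | h1
    · rw [lsv_left h1]; exact ih'.trans (gl_ge hm.1)
    · rw [lsv_right h1]
      by_contra hc
      exact h k (by omega) ⟨h1, by linarith⟩

lemma upA_zero {a : ℝ} (ha : 1 ≤ a) {κ : ℝ} (hκ : 1 < κ) :
    ∀ᵐ x ∂lam, ∀ᶠ j : ℕ in atTop, x ∈ Ico (0:ℝ) 1 → ∀ k ≤ 2^(j+1),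
      SS a κ ((2:ℝ)^j) ≤ circDist ((lsv a)^[k] x) 0 := by
  have := genA ha hκ (b := 1/2) (by norm_num) (by norm_num)
    (J := fun j => (Ico (1/2) (1/2 + SS a κ ((2:ℝ)^j)/2) ∪ Ioo (1 - SS a κ ((2:ℝ)^j)) 1) ∩ Ico (1/2) 1)
    (fun j => (measurableSet_Ico.union measurableSet_Ioo).inter measurableSet_Ico)
    (fun j => inter_subset_right) (by
      filter_upwards [eventually_ge_atTop 1] with j hj
      have := SS_pos (a := a) (κ := κ) hj
      refine (measureReal_mono inter_subset_left).trans ((measureReal_union_le _ _).trans ?_)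
      have h1 := lam_small (E := Ico (1/2) (1/2 + SS a κ ((2:ℝ)^j)/2)) Ico_subset_Icc_self (by linarith)
      have h2 := lam_small (Ioo_subset_Icc_self (a := 1 - SS a κ ((2:ℝ)^j)) (b := 1)) (by linarith)
      linarith)
  have hz : ∀ᵐ x ∂lam, x ≠ 0 := by
    have : lam {(0:ℝ)} = 0 := le_antisymm (lam_le.trans (by simp)) zero_le
    exact compl_mem_ae_iff.2 this
  filter_upwards [this, hz] with x hx hx0
  by_cases hx1 : x ∈ Ico (0:ℝ) 1
  swap
  · exact Eventually.of_forall fun j h => absurd h hx1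
  have hxp : 0 < x := lt_of_le_of_ne hx1.1 hx0.symm
  filter_upwards [hx, SS_small ha hκ (by norm_num : (0:ℝ) < 1/2), SS_small ha hκ hxp,
    eventually_ge_atTop 1] with j h2 h3 h4 hj _ k hk
  have hS := SS_pos (a := a) (κ := κ) hj
  have hm := iter_mem ha hx1 k
  have h5 := h2 hx1
  have h6 := trace_back ha hx1 h4.le k (fun i hi hc => by
    refine h5 i (hi.trans hk) ⟨Or.inl hc, hc.1, (iter_mem ha hx1 i).2⟩)
  have h7 := h5 k hk
  set y := (lsv a)^[k] x
  set S := SS a κ ((2:ℝ)^j)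
  unfold circDist
  rw [sub_zero, abs_of_nonneg hm.1]
  refine le_min h6 ?_
  by_contra hc
  exact h7 ⟨Or.inr ⟨by linarith, hm.2⟩, by linarith, hm.2⟩

lemma RR_small {a : ℝ} (ha : 1 ≤ a) {κ : ℝ} :
    ∀ᶠ j : ℕ in atTop, RR a κ ((2:ℝ)^j) < 1 := by
  have h1 := (isLittleO_log_rpow_rpow_atTop κ (by positivity : 0 < 1/a)).tendsto_div_nhds_zero
  exact (h1.comp two_pow_top).eventually (gt_mem_nhds one_pos)

lemma RR_pos {a κ : ℝ} {j : ℕ} (hj : 1 ≤ j) : 0 < RR a κ ((2:ℝ)^j) := by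
  unfold RR
  have : 0 < Real.log ((2:ℝ)^j) := Real.log_pos (one_lt_pow₀ (by norm_num) (by omega))
  positivity

lemma genB {a : ℝ} (ha : 1 ≤ a) {κ xt : ℝ} {L : ℕ → ℕ} {p : ℝ} (hp : 2 + p < κ)
    (hL1 : ∀ j, 1 ≤ L j) (hLp : ∀ᶠ j : ℕ in atTop, (L j : ℝ) ≤ 5 * (j:ℝ) ^ p)
    (hB : ∀ᶠ j : ℕ in atTop, RR a κ ((2:ℝ)^j) / 4 / 4 ≤ 
      lam.real (BB a (II xt (RR a κ ((2:ℝ)^j) / 4)) (L j))) :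
    ∀ᵐ x ∂lam, ∀ᶠ j : ℕ in atTop, x ∈ Ico (0:ℝ) 1 → ∃ k < 2^j + 1,
      |(lsv a)^[k] x - xt| ≤ RR a κ ((2:ℝ)^j) / 4 := by
  obtain ⟨C, hC, hv⟩ := hit_bound ha
  have hl2 : 0 < Real.log 2 := Real.log_pos (by norm_num)
  have ha0 : 0 < a := by linarith
  have hsum : Summable (fun j : ℕ => (C * 3 * 5 * 4 * (Real.log 2 ^ κ)⁻¹) * (j:ℝ) ^ (1 + p - κ)) :=
    (Real.summable_nat_rpow.2 (by linarith)).mul_left _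
  have := bc (s := fun j => {x | x ∈ Ico (0:ℝ) 1 ∧ ¬ ∃ k < 2^j + 1,
      |(lsv a)^[k] x - xt| ≤ RR a κ ((2:ℝ)^j) / 4}) hsum (by
    filter_upwards [hLp, hB, eventually_ge_atTop 1] with j hj hjB hj1
    have hR := RR_pos (a := a) (κ := κ) hj1
    refine (hv xt _ (L j) (by linarith) (hL1 j) hjB (2^j)).trans ?_
    have hj0 : (0:ℝ) < j := by exact_mod_cast hj1
    have hj1' : (1:ℝ) ≤ j := by exact_mod_cast hj1
    have h2j : (1:ℝ) ≤ 2^j := one_le_pow₀ (by norm_num)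
    push_cast
    have e1 : ((2:ℝ)^j + 1) ^ (-(1/a)) ≤ ((2:ℝ)^j) ^ (-(1/a)) :=
      Real.rpow_le_rpow_of_nonpos (by positivity) (by linarith) (by simp; linarith)
    have e2 : 1 + Real.log ((2:ℝ)^j + 1) ≤ 3 * j := by
      have : Real.log ((2:ℝ)^j + 1) ≤ Real.log ((2:ℝ)^(j+1)) := 
        Real.log_le_log (by positivity) (by rw [pow_succ]; linarith)
      rw [log_two_pow] at this
      push_cast at this
      have h3 : Real.log 2 ≤ 1 := by have := Real.log_two_lt_d9; linarith
      nlinarith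
    have e3 : 0 ≤ 1 + Real.log ((2:ℝ)^j + 1) := by
      have := Real.log_nonneg (by linarith : (1:ℝ) ≤ 2^j+1); linarith
    calc C * (((2:ℝ)^j + 1) ^ (-(1/a)) * (1 + Real.log ((2:ℝ)^j + 1))) * ((L j : ℝ) / (RR a κ ((2:ℝ)^j) / 4))
        ≤ C * (((2:ℝ)^j) ^ (-(1/a)) * (3 * j)) * ((5 * (j:ℝ)^p) / (RR a κ ((2:ℝ)^j) / 4)) := by
          gcongr
      _ = _ := by
          unfold RR
          rw [log_two_pow, Real.mul_rpow hj0.le hl2.le, Real.rpow_neg (by positivity),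
            Real.rpow_sub hj0, Real.rpow_add hj0, Real.rpow_one]
          have : (0:ℝ) < ((2:ℝ)^j) ^ (1/a) := by positivity
          have : (0:ℝ) < (j:ℝ) ^ κ := by positivity
          have : (0:ℝ) < Real.log 2 ^ κ := by positivity
          field_simp)
  filter_upwards [this] with x hx
  filter_upwards [hx] with j hj hx1
  by_contra hc
  exact hj ⟨hx1, hc⟩

lemma loB_zero {a : ℝ} (ha : 1 ≤ a) {κ : ℝ} (hκ : 2 < κ) :
    ∀ᵐ x ∂lam, ∀ᶠ j : ℕ in atTop, x ∈ Ico (0:ℝ) 1 → ∃ k < 2^j + 1,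
      |(lsv a)^[k] x - 0| ≤ RR a κ ((2:ℝ)^j) / 4 := by
  refine genB ha (p := 0) (L := fun _ => 2) (by linarith) (fun _ => by norm_num) ?_ ?_
  · exact Eventually.of_forall fun j => by norm_num
  · filter_upwards [RR_small (κ := κ) ha, eventually_ge_atTop 1] with j h1 h2
    have := RR_pos (a := a) (κ := κ) h2
    exact BB_two ha (by linarith) (by linarith)

lemma loB_ne {a : ℝ} (ha : 1 ≤ a) {κ : ℝ} (hκ : 4 < κ) {xt : ℝ} (hxt : xt ∈ Ico (0:ℝ) 1) :
    ∀ᵐ x ∂lam, ∀ᶠ j : ℕ in atTop, x ∈ Ico (0:ℝ) 1 → ∃ k < 2^j + 1,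
      |(lsv a)^[k] x - xt| ≤ RR a κ ((2:ℝ)^j) / 4 := by
  refine genB ha (p := 1) (L := fun j => j + 4) (by linarith) (fun _ => by omega) ?_ ?_
  · filter_upwards [eventually_ge_atTop 1] with j hj
    have : (1:ℝ) ≤ j := by exact_mod_cast hj
    rw [Real.rpow_one]; push_cast; linarith
  · filter_upwards [RR_small (κ := κ) ha, eventually_ge_atTop 2] with j h1 h2
    have h3 := RR_pos (a := a) (κ := κ) (by omega : 1 ≤ j)
    refine BB_one ha hxt (by linarith) (by linarith) (by omega) ?_
    have h2j : (1:ℝ) ≤ 2^j := one_le_pow₀ (by norm_num)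
    have h4 : 1 ≤ RR a κ ((2:ℝ)^j) * 2^j := by
      unfold RR
      rw [div_mul_eq_mul_div, one_le_div₀ (by positivity)]
      have e1 : ((2:ℝ)^j) ^ (1/a) ≤ 2^j := by
        conv_rhs => rw [← Real.rpow_one ((2:ℝ)^j)]
        refine Real.rpow_le_rpow_of_exponent_le h2j ?_
        rw [div_le_one (by linarith)]; exact ha
      have e2 : 1 ≤ Real.log ((2:ℝ)^j) ^ κ := by
        refine Real.one_le_rpow ?_ (by linarith)
        rw [log_two_pow]
        have := Real.log_two_gt_d9
        have : (2:ℝ) ≤ j := by exact_mod_cast h2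
        nlinarith
      nlinarith
    rw [pow_add]
    nlinarith

/-- passing from dyadic scales to all times -/
lemma fin_lemma {a : ℝ} (ha : 1 ≤ a) {κ κ' : ℝ} (hκ : 0 < κ) (hκ' : 0 < κ') 
    {ψ : ℝ → ℝ} (hψ : AntitoneOn ψ (Set.Ici 0)) {xt : ℝ} (hxt : xt ∈ Ico (0:ℝ) 1)
    (hA : ∀ᵐ x ∂lam, ∀ᶠ j : ℕ in atTop, x ∈ Ico (0:ℝ) 1 → ∀ k ≤ 2^(j+1),
      SS a κ ((2:ℝ)^j) ≤ circDist ((lsv a)^[k] x) xt)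
    (hB : ∀ᵐ x ∂lam, ∀ᶠ j : ℕ in atTop, x ∈ Ico (0:ℝ) 1 → ∃ k < 2^j + 1,
      |(lsv a)^[k] x - xt| ≤ RR a κ' ((2:ℝ)^j) / 4) :
    ∀ᵐ x ∂lam, ∀ᶠ n : ℕ in atTop,
      ψ (RR a κ' n) ≤ maxProc (lsv a) (fun y => ψ (circDist y xt)) n x ∧
      maxProc (lsv a) (fun y => ψ (circDist y xt)) n x ≤ ψ (SS a κ n) := by
  have hin : ∀ᵐ x ∂lam, x ∈ Ico (0:ℝ) 1 := ae_restrict_mem measurableSet_Ico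
  have ha0 : 0 < a := by linarith
  filter_upwards [hA, hB, hin] with x hxA hxB hx
  obtain ⟨j1, h1⟩ := eventually_atTop.1 hxA
  obtain ⟨j2, h2⟩ := eventually_atTop.1 hxB
  have hcd : ∀ k, 0 ≤ circDist ((lsv a)^[k] x) xt := by
    intro k
    have hm := iter_mem ha hx k
    unfold circDist
    refine le_min (abs_nonneg _) ?_
    have : |(lsv a)^[k] x - xt| ≤ 1 := by
      rw [abs_le]; constructor <;> linarith [hm.1, hm.2, hxt.1, hxt.2]
    linarith
  filter_upwards [eventually_ge_atTop (2^(j1 + j2 + 2))] with n hn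
  set m := Nat.log 2 n with hm
  have hn0 : n ≠ 0 := by have : 0 < 2^(j1+j2+2) := by positivity
                         omega
  have hm1 : j1 + j2 + 2 ≤ m := Nat.le_log_of_pow_le (by norm_num) hn
  have hm2 : 2^m ≤ n := Nat.pow_log_le_self 2 hn0
  have hm3 : n < 2^(m+1) := Nat.lt_pow_succ_log_self (by norm_num) n
  have hm2' : (2:ℝ)^m ≤ n := by exact_mod_cast hm2
  have hm3' : (n:ℝ) < 2^(m+1) := by exact_mod_cast hm3
  constructor
  · obtain ⟨i, hi⟩ : ∃ i, m = i + 1 := ⟨m-1, by omega⟩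
    obtain ⟨k, hk, hkd⟩ := h2 i (by omega) hx
    have hkn : k < n := by
      have : 2^m = 2^i * 2 := by rw [hi, pow_succ]
      have : 0 < 2^i := by positivity
      omega
    have hlog : 0 < Real.log ((2:ℝ)^i) := Real.log_pos (one_lt_pow₀ (by norm_num) (by omega))
    have h2i : (1:ℝ) ≤ 2^i := one_le_pow₀ (by norm_num)
    have hr : RR a κ' ((2:ℝ)^i) / 4 ≤ RR a κ' n := by
      unfold RR
      rw [div_div]
      have hnp : (0:ℝ) < n := by positivity
      have e0 : (2:ℝ)^i ≤ n := by rw [hi, pow_succ] at hm2'; linarith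
      have e1 : (n:ℝ) ^ (1/a) ≤ ((2:ℝ)^i) ^ (1/a) * 4 := by
        have : (n:ℝ) ≤ (2:ℝ)^i * 4 := by rw [hi, pow_succ, pow_succ] at hm3'; linarith
        refine (Real.rpow_le_rpow hnp.le this (by positivity)).trans ?_
        rw [Real.mul_rpow (by positivity) (by norm_num)]
        gcongr
        conv_rhs => rw [← Real.rpow_one (4:ℝ)]
        refine Real.rpow_le_rpow_of_exponent_le (by norm_num) ?_
        rw [div_le_one (by linarith)]; exact ha
      have e2 : Real.log ((2:ℝ)^i) ≤ Real.log n := Real.log_le_log (by positivity) e0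
      have : 0 ≤ Real.log n := by linarith
      gcongr
    have hc : circDist ((lsv a)^[k] x) xt ≤ RR a κ' n := (min_le_left _ _).trans (hkd.trans hr)
    unfold maxProc
    refine le_trans ?_ (le_ciSup (f := fun k : Fin n => ψ (circDist ((lsv a)^[k] x) xt))
      (Set.finite_range _).bddAbove ⟨k, hkn⟩)
    exact hψ (hcd k) ((hcd k).trans hc) hc
  · have : Nonempty (Fin n) := ⟨⟨0, by omega⟩⟩
    unfold maxProc
    refine ciSup_le fun k => ?_
    have h3 := h1 m (by omega) hx k (by have := k.2; omega)
    have hlog : 0 < Real.log ((2:ℝ)^m) := Real.log_pos (one_lt_pow₀ (by norm_num) (by omega))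
    have e2 : Real.log ((2:ℝ)^m) ≤ Real.log n := Real.log_le_log (by positivity) hm2'
    have hlogn : 0 < Real.log n := by linarith
    have hr : SS a κ n ≤ SS a κ ((2:ℝ)^m) := by
      unfold SS
      gcongr
    have hs0 : 0 ≤ SS a κ n := by unfold SS; positivity
    exact hψ hs0 (hcd k) (hr.trans h3)

end LSV

/-- Theorem: almost sure growth of maxima of `φ(x) = ψ(d(x,x̃))` for the
intermittent map with `α ≥ 1` (infinite measure case). -/
theorem lsv_maxima_growth
    (a : ℝ) (ha : 1 ≤ a)
    (ψ : ℝ → ℝ) (hψdec : AntitoneOn ψ (Set.Ici 0))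
    (xt : ℝ) (hxt : xt ∈ Set.Ico (0 : ℝ) 1) :
    ∀ ε : ℝ, 0 < ε →
      ((xt = 0 →
        ∀ᵐ x ∂(volume.restrict (Set.Ico (0 : ℝ) 1)), ∀ᶠ n : ℕ in atTop,
          ψ (Real.log n ^ (2 + ε) / (n : ℝ) ^ (1 / a))
              ≤ maxProc (lsv a) (fun y => ψ (circDist y xt)) n x ∧
          maxProc (lsv a) (fun y => ψ (circDist y xt)) n x
              ≤ ψ (1 / ((n : ℝ) ^ (1 / a) * Real.log n ^ (2 + ε)))) ∧
      (xt ≠ 0 →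
        ∀ᵐ x ∂(volume.restrict (Set.Ico (0 : ℝ) 1)), ∀ᶠ n : ℕ in atTop,
          ψ (Real.log n ^ (4 + ε) / (n : ℝ) ^ (1 / a))
              ≤ maxProc (lsv a) (fun y => ψ (circDist y xt)) n x ∧
          maxProc (lsv a) (fun y => ψ (circDist y xt)) n x
              ≤ ψ (1 / ((n : ℝ) ^ (1 / a) * Real.log n ^ (2 + ε))))) := by
  intro ε hε
  constructor
  · rintro rfl
    have := LSV.fin_lemma ha (κ := 2 + ε) (κ' := 2 + ε) (by linarith) (by linarith) hψdec hxt
      (LSV.upA_zero ha (by linarith)) (LSV.loB_zero ha (by linarith))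
    exact this
  · intro hne
    have := LSV.fin_lemma ha (κ := 2 + ε) (κ' := 4 + ε) (by linarith) (by linarith) hψdec hxt
      (LSV.upA_ne ha (by linarith) (lt_of_le_of_ne hxt.1 hne.symm) hxt.2)
      (LSV.loB_ne ha (by linarith) hxt)
    exact this
end
end
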